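/- arXiv:1901.07133 — 2 statements merged into one kernel-verified Lean document; each statement's English description precedes it below -/
import Mathlib

section
/- Let m be a positive integer and let G be a finite group. Then G admits an m-DRR if and only if (m,G) is NOT one of the following pairs: m=1 and G isomorphic to Q8, (Z/2)², (Z/2)³, (Z/2)⁴ or (Z/3)²; m=2 and G isomorphic to the trivial group or Z/2; m ∈ {3,4,5} and G the trivial group. -/
/-- A permutation `σ` is an automorphism of the digraph with arc relation `A`. -/
def IsDigraphAut {V : Type*} (A : V → V → Prop) (σ : Equiv.Perm V) : Prop :=
  ∀ u v : V, A (σ u) (σ v) ↔ A u v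

/-- `G` admits an `m`-digraphical regular representation: a regular finite digraph whose
full automorphism group is (the image of) `G`, acting semiregularly with exactly `m` orbits. -/
def HasMDRR (G : Type*) [Group G] (m : ℕ) : Prop :=
  ∃ (V : Type) (_ : Fintype V) (A : V → V → Prop) (ρ : G →* Equiv.Perm V),
    (∀ v : V, ¬ A v v) ∧
    (∃ d : ℕ, ∀ v : V, {u | A v u}.ncard = d ∧ {u | A u v}.ncard = d) ∧
    (∀ g : G, IsDigraphAut A (ρ g)) ∧
    (∀ σ : Equiv.Perm V, IsDigraphAut A σ → ∃ g : G, ρ g = σ) ∧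
    Function.Injective ⇑ρ ∧
    (∀ (g : G) (v : V), ρ g v = v → g = 1) ∧
    (∃ reps : Fin m → V, ∀ v : V, ∃! i : Fin m, ∃ g : G, ρ g (reps i) = v)

namespace MCayley

variable {G : Type} [Group G] {m : ℕ}

/-- The arcs of the `m`-Cayley digraph with connection sets `S i j`. -/
def Arc (S : Fin m → Fin m → Set G) (u v : Fin m × G) : Prop :=
  u.2⁻¹ * v.2 ∈ S u.1 v.1

/-- `f` restricts to an automorphism of the sub-digraph on the vertices with label in `H`. -/
structure LocalAut (S : Fin m → Fin m → Set G) (H : Subgroup G)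
    (f : Fin m × G → Fin m × G) : Prop where
  maps : ∀ u : Fin m × G, u.2 ∈ H → (f u).2 ∈ H
  inj : ∀ u v : Fin m × G, u.2 ∈ H → v.2 ∈ H → f u = f v → u = v
  arc : ∀ u v : Fin m × G, u.2 ∈ H → v.2 ∈ H → (Arc S (f u) (f v) ↔ Arc S u v)

/-- All automorphisms of the sub-digraph on `H` are left translations. -/
def Rigid (S : Fin m → Fin m → Set G) (H : Subgroup G) : Prop :=
  ∀ f, LocalAut S H f → ∃ h ∈ H, ∀ i, ∀ x ∈ H, f (i, x) = (i, h * x)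

/-- The connection sets `S`, contained in `H`, define an `m`-DRR of `H` of valency `c`. -/
structure Rep (S : Fin m → Fin m → Set G) (H : Subgroup G) (c : ℕ) : Prop where
  supp : ∀ i j, S i j ⊆ H
  loopless : ∀ i, (1 : G) ∉ S i i
  outdeg : ∀ i, {p : Fin m × G | p.2 ∈ S i p.1}.ncard = c
  indeg : ∀ i, {p : Fin m × G | p.2 ∈ S p.1 i}.ncard = c
  rigid : Rigid S H

/-- The connection sets of the complementary digraph on `H`. -/
def compl (S : Fin m → Fin m → Set G) (H : Subgroup G) : Fin m → Fin m → Set G :=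
  fun i j => {x | x ∈ H ∧ x ∉ S i j ∧ ¬ (i = j ∧ x = 1)}

lemma arc_translate (S : Fin m → Fin m → Set G) (g : G) (i j : Fin m) (x y : G) :
    Arc S (i, g * x) (j, g * y) ↔ Arc S (i, x) (j, y) := by
  simp [Arc, mul_assoc]

lemma arc_compl {S : Fin m → Fin m → Set G} {H : Subgroup G} {u v : Fin m × G}
    (hu : u.2 ∈ H) (hv : v.2 ∈ H) : Arc (compl S H) u v ↔ ¬ Arc S u v ∧ u ≠ v := by
  obtain ⟨i, x⟩ := u
  obtain ⟨j, y⟩ := v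
  have h : x⁻¹ * y ∈ H := H.mul_mem (H.inv_mem hu) hv
  simp [Arc, compl, h, inv_mul_eq_one]

lemma Rigid.compl {S : Fin m → Fin m → Set G} {H : Subgroup G} (hl : ∀ i, (1 : G) ∉ S i i)
    (h : Rigid S H) : Rigid (compl S H) H := by
  intro f hf
  refine h f ⟨hf.maps, hf.inj, fun u v hu hv => ?_⟩
  have h1 := hf.arc u v hu hv
  rw [arc_compl (hf.maps u hu) (hf.maps v hv), arc_compl hu hv] at h1
  by_cases huv : u = v
  · subst huv
    simp [Arc, hl]
  · have : f u ≠ f v := fun e => huv (hf.inj u v hu hv e)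
    tauto

lemma ncard_label_mem [Finite G] (H : Subgroup G) :
    {p : Fin m × G | p.2 ∈ H}.ncard = m * Nat.card H := by
  have : {p : Fin m × G | p.2 ∈ H} = (Set.univ : Set (Fin m)) ×ˢ (H : Set G) := by
    ext p; simp
  rw [this, Set.ncard_prod, Set.ncard_univ, Nat.card_fin]
  rfl

lemma ncard_compl_aux [Finite G] {H : Subgroup G} {A B : Set (Fin m × G)} (i : Fin m)
    (hA : ∀ p ∈ A, p.2 ∈ H) (hi : (i, (1 : G)) ∉ A)
    (hB : ∀ p, p ∈ B ↔ p.2 ∈ H ∧ p ∉ A ∧ p ≠ (i, 1)) :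
    B.ncard = m * Nat.card H - 1 - A.ncard := by
  have h1 : B = ({p : Fin m × G | p.2 ∈ H} \ {(i, 1)}) \ A := by
    ext p; simp [hB]; tauto
  have h2 : A ⊆ {p : Fin m × G | p.2 ∈ H} \ {(i, 1)} := fun p hp =>
    ⟨hA p hp, fun e => hi (e ▸ hp)⟩
  rw [h1, Set.ncard_sdiff h2, Set.ncard_sdiff_singleton_of_mem (by simp), ncard_label_mem]

lemma Rep.compl [Finite G] {S : Fin m → Fin m → Set G} {H : Subgroup G} {c : ℕ}
    (h : Rep S H c) : Rep (compl S H) H (m * Nat.card H - 1 - c) where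
  supp := fun _ _ _ hx => hx.1
  loopless := fun i hx => hx.2.2 ⟨rfl, rfl⟩
  outdeg := fun i => by
    rw [← h.outdeg i]
    refine ncard_compl_aux i (fun p hp => h.supp _ _ hp) (h.loopless i) ?_
    rintro ⟨j, x⟩
    simp [MCayley.compl, eq_comm]
  indeg := fun i => by
    rw [← h.indeg i]
    refine ncard_compl_aux i (fun p hp => h.supp _ _ hp) (h.loopless i) ?_
    rintro ⟨j, x⟩
    simp [MCayley.compl]
  rigid := h.rigid.compl h.loopless

lemma ncard_outNeighbors [Finite G] {S : Fin m → Fin m → Set G} (u : Fin m × G) :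
    {v | Arc S u v}.ncard = {p : Fin m × G | p.2 ∈ S u.1 p.1}.ncard := by
  have h : {v | Arc S u v} =
      (fun p : Fin m × G => (p.1, u.2 * p.2)) '' {p : Fin m × G | p.2 ∈ S u.1 p.1} := by
    ext ⟨j, y⟩
    simp only [Arc, Set.mem_ofPred_eq, Set.mem_image, Prod.exists, Prod.mk.injEq]
    constructor
    · intro hy
      exact ⟨j, u.2⁻¹ * y, hy, rfl, by simp⟩
    · rintro ⟨j', y', hy, rfl, rfl⟩
      simpa using hy
  rw [h, Set.ncard_image_of_injective]
  rintro ⟨i, x⟩ ⟨j, y⟩ e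
  simpa using e

lemma ncard_inNeighbors [Finite G] {S : Fin m → Fin m → Set G} (v : Fin m × G) :
    {u | Arc S u v}.ncard = {p : Fin m × G | p.2 ∈ S p.1 v.1}.ncard := by
  have h : {u | Arc S u v} =
      (fun p : Fin m × G => (p.1, v.2 * p.2⁻¹)) '' {p : Fin m × G | p.2 ∈ S p.1 v.1} := by
    ext ⟨j, y⟩
    simp only [Arc, Set.mem_ofPred_eq, Set.mem_image, Prod.exists, Prod.mk.injEq]
    constructor
    · intro hy
      exact ⟨j, y⁻¹ * v.2, hy, rfl, by simp⟩
    · rintro ⟨j', y', hy, rfl, rfl⟩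
      simpa using hy
  rw [h, Set.ncard_image_of_injective]
  rintro ⟨i, x⟩ ⟨j, y⟩ e
  simpa using e

lemma Rep.hasMDRR [Finite G] {S : Fin m → Fin m → Set G} {c : ℕ} (hm : 1 ≤ m)
    (h : Rep S ⊤ c) : HasMDRR G m := by
  classical
  have := Fintype.ofFinite G
  let ρ : G →* Equiv.Perm (Fin m × G) :=
    { toFun := fun g => Equiv.prodCongr (Equiv.refl _) (Equiv.mulLeft g)
      map_one' := by ext x <;> simp
      map_mul' := fun g k => by ext x <;> simp [mul_assoc] }
  have hρ : ∀ g i x, ρ g (i, x) = (i, g * x) := fun g i x => rfl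
  refine ⟨Fin m × G, inferInstance, Arc S, ρ, ?_, ⟨c, fun v => ⟨?_, ?_⟩⟩, ?_, ?_, ?_, ?_, ?_⟩
  · rintro v hv
    exact h.loopless v.1 (by simpa [Arc] using hv)
  · rw [ncard_outNeighbors, h.outdeg]
  · rw [ncard_inNeighbors, h.indeg]
  · rintro g ⟨i, x⟩ ⟨j, y⟩
    exact arc_translate S g i j x y
  · intro σ hσ
    obtain ⟨g, -, hg⟩ := h.rigid σ ⟨fun _ _ => trivial, fun u v _ _ e => σ.injective e,
      fun u v _ _ => hσ u v⟩
    refine ⟨g, Equiv.ext ?_⟩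
    rintro ⟨i, x⟩
    rw [hρ, hg i x trivial]
  · intro g k e
    have := congrArg (fun τ => τ (⟨0, hm⟩, (1 : G))) e
    simpa [hρ] using this
  · rintro g ⟨i, x⟩ e
    simpa [hρ] using e
  · refine ⟨fun i => (i, 1), ?_⟩
    rintro ⟨i, x⟩
    refine ⟨i, ⟨x, by simp [hρ]⟩, ?_⟩
    rintro j ⟨g, hg⟩
    simp only [hρ, Prod.mk.injEq] at hg
    exact hg.1

lemma LocalAut.conj_translate {S : Fin m → Fin m → Set G} {H K : Subgroup G}
    {f : Fin m × G → Fin m × G} (hf : LocalAut S K f) (hHK : H ≤ K) {x y : G} (hx : x ∈ K)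
    (hmaps : ∀ i, ∀ h ∈ H, y⁻¹ * (f (i, x * h)).2 ∈ H) :
    LocalAut S H (fun p => ((f (p.1, x * p.2)).1, y⁻¹ * (f (p.1, x * p.2)).2)) where
  maps := fun u hu => hmaps u.1 u.2 hu
  inj := by
    rintro ⟨i, g⟩ ⟨j, k⟩ hg hk e
    simp only [Prod.mk.injEq, mul_right_inj] at e
    have := hf.inj (i, x * g) (j, x * k) (K.mul_mem hx (hHK hg)) (K.mul_mem hx (hHK hk))
      (Prod.ext e.1 e.2)
    simpa using this
  arc := by
    rintro ⟨i, g⟩ ⟨j, k⟩ hg hk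
    rw [arc_translate S y⁻¹]
    exact (hf.arc (i, x * g) (j, x * k) (K.mul_mem hx (hHK hg)) (K.mul_mem hx (hHK hk))).trans
      (arc_translate S x i j g k)

/-- Adjoin the element `b` to every diagonal connection set. -/
def adjoin (S : Fin m → Fin m → Set G) (b : G) : Fin m → Fin m → Set G :=
  fun i j => {x | x ∈ S i j ∨ (i = j ∧ x = b)}

/-- Every arc is the long side of a transitive triangle. -/
def Transit (T : Fin m → Fin m → Set G) : Prop :=
  ∀ i j, ∀ t ∈ T i j, ∃ k, ∃ s ∈ T i k, s⁻¹ * t ∈ T k j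

/-- The vertices with label in `H` lie in one weakly connected component. -/
def Linked (T : Fin m → Fin m → Set G) (H : Subgroup G) : Prop :=
  ∀ i j, ∀ x ∈ H, Relation.EqvGen (Arc T) (i, 1) (j, x)

lemma arc_adjoin {T : Fin m → Fin m → Set G} {b : G} {u v : Fin m × G} :
    Arc (adjoin T b) u v ↔ Arc T u v ∨ (u.1 = v.1 ∧ u.2⁻¹ * v.2 = b) := Iff.rfl

lemma LocalAut.exists_eq [Finite G] {S : Fin m → Fin m → Set G} {K : Subgroup G}
    {f : Fin m × G → Fin m × G} (hf : LocalAut S K f) (w : Fin m × G) (hw : w.2 ∈ K) :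
    ∃ v : Fin m × G, v.2 ∈ K ∧ f v = w := by
  have hmaps : Set.MapsTo f {p | p.2 ∈ K} {p | p.2 ∈ K} := fun u hu => hf.maps u hu
  have hinj : Set.InjOn f {p | p.2 ∈ K} := fun u hu v hv e => hf.inj u v hu hv e
  have := (((Set.toFinite _).injOn_iff_bijOn_of_mapsTo hmaps).1 hinj).surjOn
  obtain ⟨v, hv, e⟩ := this hw
  exact ⟨v, hv, e⟩

/-- A map commuting with right multiplication by generators of `H` is a left translation. -/
lemma exists_translation {H : Subgroup G} {L : Set G} (hL : Subgroup.closure L = H)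
    {f : Fin m × G → Fin m × G} {z : G → G} (hz1 : z 1 ∈ H)
    (hval : ∀ x ∈ H, ∀ i, f (i, x) = (i, z x))
    (hz : ∀ l ∈ L, ∀ x ∈ H, z (x * l) = z x * l) :
    ∃ h ∈ H, ∀ i, ∀ x ∈ H, f (i, x) = (i, h * x) := by
  have hzmul : ∀ k ∈ Subgroup.closure L, ∀ x ∈ H, z (x * k) = z x * k := by
    intro k hk
    induction hk using Subgroup.closure_induction with
    | mem k hk => exact hz k hk
    | one => simp
    | mul k l hk hl ihk ihl =>
      rw [hL] at hk hl
      intro x hx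
      rw [← mul_assoc, ihl _ (H.mul_mem hx hk), ihk x hx, mul_assoc]
    | inv k hk ih =>
      rw [hL] at hk
      intro x hx
      have := ih (x * k⁻¹) (H.mul_mem hx (H.inv_mem hk))
      rw [inv_mul_cancel_right] at this
      rw [this, mul_inv_cancel_right]
  refine ⟨z 1, hz1, fun i x hx => ?_⟩
  rw [hval x hx, ← hzmul x (hL.symm ▸ hx) 1 H.one_mem, one_mul]

lemma arc_iff_of_transit {T : Fin m → Fin m → Set G} {H K : Subgroup G}
    (supp : ∀ i j, T i j ⊆ H) (loopless : ∀ i, (1 : G) ∉ T i i) (tr : Transit T)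
    (hHK : H ≤ K) {b : G} (hb : b ∉ H) {u v : Fin m × G} (hu : u.2 ∈ K) :
    Arc T u v ↔ Arc (adjoin T b) u v ∧
      ∃ w : Fin m × G, w.2 ∈ K ∧ Arc (adjoin T b) u w ∧ Arc (adjoin T b) w v := by
  obtain ⟨i, x⟩ := u
  obtain ⟨j, y⟩ := v
  constructor
  · intro h
    refine ⟨Or.inl h, ?_⟩
    obtain ⟨k, s, hs, hst⟩ := tr i j _ h
    refine ⟨(k, x * s), K.mul_mem hu (hHK (supp _ _ hs)), Or.inl ?_, Or.inl ?_⟩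
    · simpa [Arc] using hs
    · simpa [Arc, mul_assoc] using hst
  · rintro ⟨h, ⟨k, z⟩, -, h1, h2⟩
    rw [arc_adjoin] at h h1 h2
    simp only [Arc] at h h1 h2 ⊢
    rcases h with h | ⟨rfl, h⟩
    · exact h
    exfalso
    have e : x⁻¹ * z * (z⁻¹ * y) = b := by rw [← h]; group
    rcases h1 with h1 | ⟨rfl, h1⟩
    · rcases h2 with h2 | ⟨rfl, h2⟩
      · exact hb (e ▸ H.mul_mem (supp _ _ h1) (supp _ _ h2))
      · rw [h2, mul_eq_right] at e
        rw [e] at h1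
        exact loopless _ h1
    · rw [h1, mul_eq_left] at e
      rw [e] at h2
      rcases h2 with h2 | ⟨-, h2⟩
      · exact loopless _ h2
      · exact hb (h2 ▸ H.one_mem)

lemma rigid_adjoin [Finite G] {T : Fin m → Fin m → Set G} {H : Subgroup G} (hm : 1 ≤ m)
    (supp : ∀ i j, T i j ⊆ H) (loopless : ∀ i, (1 : G) ∉ T i i) (rig : Rigid T H)
    (tr : Transit T) (lk : Linked T H) {b : G} (hb : b ∉ H) :
    Rigid (adjoin T b) (H ⊔ Subgroup.zpowers b) := by
  intro f hf
  set K := H ⊔ Subgroup.zpowers b with hK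
  have hHK : H ≤ K := le_sup_left
  have hbK : b ∈ K := (le_sup_right : Subgroup.zpowers b ≤ K) (Subgroup.mem_zpowers b)
  have hT : ∀ u v : Fin m × G, u.2 ∈ K → v.2 ∈ K → (Arc T (f u) (f v) ↔ Arc T u v) := by
    intro u v hu hv
    rw [arc_iff_of_transit supp loopless tr hHK hb hu,
      arc_iff_of_transit supp loopless tr hHK hb (hf.maps u hu), hf.arc u v hu hv]
    refine and_congr_right fun _ => ⟨?_, ?_⟩
    · rintro ⟨w, hw, h1, h2⟩
      obtain ⟨w', hw', rfl⟩ := hf.exists_eq w hw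
      exact ⟨w', hw', (hf.arc _ _ hu hw').1 h1, (hf.arc _ _ hw' hv).1 h2⟩
    · rintro ⟨w, hw, h1, h2⟩
      exact ⟨f w, hf.maps w hw, (hf.arc _ _ hu hw).2 h1, (hf.arc _ _ hw hv).2 h2⟩
  have hfT : LocalAut T K f := ⟨hf.maps, hf.inj, hT⟩
  have hcoset : ∀ x ∈ K, ∀ p q : Fin m × G, Relation.EqvGen (Arc T) p q →
      p.2⁻¹ * q.2 ∈ H ∧ (p.2 ∈ H → (f (p.1, x * p.2)).2⁻¹ * (f (q.1, x * q.2)).2 ∈ H) := by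
    intro x hx p q hpq
    induction hpq with
    | rel p q h =>
      refine ⟨supp _ _ h, fun hp => supp _ _ ((hT (p.1, x * p.2) (q.1, x * q.2)
        (K.mul_mem hx (hHK hp)) (K.mul_mem hx ?_)).2 ((arc_translate T x _ _ _ _).2 h))⟩
      have := H.mul_mem hp (supp _ _ h)
      rw [mul_inv_cancel_left] at this
      exact hHK this
    | refl p => simp
    | symm p q _ ih =>
      refine ⟨by simpa using H.inv_mem ih.1, fun hq => ?_⟩
      have hp : p.2 ∈ H := by
        have := H.mul_mem hq (H.inv_mem ih.1)
        simpa using this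
      simpa using H.inv_mem (ih.2 hp)
    | trans p q r _ _ ih1 ih2 =>
      refine ⟨by simpa [mul_assoc] using H.mul_mem ih1.1 ih2.1, fun hp => ?_⟩
      have hq : q.2 ∈ H := by
        have := H.mul_mem hp ih1.1
        simpa using this
      simpa [mul_assoc] using H.mul_mem (ih1.2 hp) (ih2.2 hq)
  let i₀ : Fin m := ⟨0, hm⟩
  set z : G → G := fun x => (f (i₀, x)).2 with hz
  have hblock : ∀ x ∈ K, ∀ i, ∀ h ∈ H, f (i, x * h) = (i, z x * h) := by
    intro x hx
    have hmaps : ∀ i, ∀ h ∈ H, (z x)⁻¹ * (f (i, x * h)).2 ∈ H := by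
      intro i h hh
      have := (hcoset x hx _ _ (lk i₀ i h hh)).2 H.one_mem
      simpa using this
    obtain ⟨k, hk, hfk⟩ := rig _ (hfT.conj_translate hHK hx hmaps)
    have h1 : k = 1 := by
      have := hfk i₀ 1 H.one_mem
      simpa [hz] using (congrArg Prod.snd this).symm
    subst h1
    intro i h hh
    have := hfk i h hh
    simp only [one_mul, Prod.mk.injEq] at this
    exact Prod.ext this.1 (inv_mul_eq_iff_eq_mul.1 this.2)
  have hval : ∀ x ∈ K, ∀ i, f (i, x) = (i, z x) := by
    intro x hx i
    simpa using hblock x hx i 1 H.one_mem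
  have hKc : Subgroup.closure ((H : Set G) ∪ {b}) = K := by
    rw [hK, Subgroup.closure_union, Subgroup.closure_eq, Subgroup.zpowers_eq_closure]
  refine exists_translation hKc (hf.maps (i₀, 1) K.one_mem) hval ?_
  rintro k (hk | rfl) x hx
  · exact congrArg Prod.snd (hblock x hx i₀ k hk)
  · have h1 : Arc (adjoin T k) (i₀, x) (i₀, x * k) := Or.inr ⟨rfl, by simp⟩
    have h2 : ¬ Arc T (i₀, x) (i₀, x * k) := fun h => hb (supp _ _ (by simpa [Arc] using h))
    have hxk := K.mul_mem hx hbK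
    rw [← hf.arc _ _ hx hxk, arc_adjoin] at h1
    rw [← hT _ _ hx hxk] at h2
    exact inv_mul_eq_iff_eq_mul.1 (h1.resolve_left h2).2

lemma Rep.adjoin [Finite G] {T : Fin m → Fin m → Set G} {H : Subgroup G} {d : ℕ} (hm : 1 ≤ m)
    (h : Rep T H d) (tr : Transit T) (lk : Linked T H) {b : G} (hb : b ∉ H) :
    Rep (adjoin T b) (H ⊔ Subgroup.zpowers b) (d + 1) where
  supp := by
    rintro i j x (hx | ⟨-, rfl⟩)
    · exact (le_sup_left : H ≤ _) (h.supp _ _ hx)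
    · exact (le_sup_right : Subgroup.zpowers x ≤ _) (Subgroup.mem_zpowers x)
  loopless := by
    rintro i (hx | ⟨-, rfl⟩)
    · exact h.loopless i hx
    · exact hb H.one_mem
  outdeg := fun i => by
    have e : {p : Fin m × G | p.2 ∈ MCayley.adjoin T b i p.1} =
        insert (i, b) {p : Fin m × G | p.2 ∈ T i p.1} := by
      ext ⟨j, x⟩
      simp [MCayley.adjoin, eq_comm]
      tauto
    have hn : (i, b) ∉ {p : Fin m × G | p.2 ∈ T i p.1} := fun hx => hb (h.supp i i hx)
    rw [e, Set.ncard_insert_of_notMem hn, h.outdeg]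
  indeg := fun i => by
    have e : {p : Fin m × G | p.2 ∈ MCayley.adjoin T b p.1 i} =
        insert (i, b) {p : Fin m × G | p.2 ∈ T p.1 i} := by
      ext ⟨j, x⟩
      simp [MCayley.adjoin]
      tauto
    have hn : (i, b) ∉ {p : Fin m × G | p.2 ∈ T p.1 i} := fun hx => hb (h.supp i i hx)
    rw [e, Set.ncard_insert_of_notMem hn, h.indeg]
  rigid := rigid_adjoin hm h.supp h.loopless h.rigid tr lk hb

lemma inter_nonempty_of_ncard [Finite G] {H : Subgroup G} {d : ℕ} (hd : m * Nat.card H < 2 * d)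
    {A B : Set (Fin m × G)} (hA : ∀ p ∈ A, p.2 ∈ H) (hB : ∀ p ∈ B, p.2 ∈ H)
    (hAd : A.ncard = d) (hBd : B.ncard = d) : ∃ p, p ∈ A ∧ p ∈ B := by
  by_contra! hne
  have hdis : Disjoint A B := Set.disjoint_left.2 hne
  have h1 := Set.ncard_union_eq hdis
  have h2 : (A ∪ B).ncard ≤ {p : Fin m × G | p.2 ∈ H}.ncard :=
    Set.ncard_le_ncard (Set.union_subset hA hB)
  rw [ncard_label_mem] at h2
  omega

lemma Rep.transit_of_dense [Finite G] {T : Fin m → Fin m → Set G} {H : Subgroup G} {d : ℕ}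
    (h : Rep T H d) (hd : m * Nat.card H < 2 * d) : Transit T := by
  intro i j t ht
  have htH := h.supp _ _ ht
  obtain ⟨⟨k, s⟩, h1, h2⟩ := inter_nonempty_of_ncard hd
    (A := {p : Fin m × G | p.2 ∈ T i p.1}) (B := {u | Arc T u (j, t)})
    (fun p hp => h.supp _ _ hp)
    (fun p hp => by
      have := H.mul_mem htH (H.inv_mem (h.supp _ _ hp))
      simpa using this)
    (h.outdeg i) (by rw [ncard_inNeighbors]; exact h.indeg j)
  exact ⟨k, s, h1, h2⟩

lemma Rep.linked_of_dense [Finite G] {T : Fin m → Fin m → Set G} {H : Subgroup G} {d : ℕ}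
    (h : Rep T H d) (hd : m * Nat.card H < 2 * d) : Linked T H := by
  intro i j x hx
  obtain ⟨w, h1, h2⟩ := inter_nonempty_of_ncard hd
    (A := {w | Arc T (i, 1) w}) (B := {w | Arc T (j, x) w})
    (fun p hp => by simpa using h.supp _ _ hp)
    (fun p hp => by
      have := H.mul_mem hx (h.supp _ _ hp)
      simpa using this)
    (by rw [ncard_outNeighbors]; exact h.outdeg i)
    (by rw [ncard_outNeighbors]; exact h.outdeg j)
  exact .trans _ w _ (.rel _ _ h1) (.symm _ _ (.rel _ _ h2))

/-- `H` admits a sparse `m`-DRR: such a representation extends to every overgroup of `H`. -/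
def Good (m : ℕ) (H : Subgroup G) : Prop :=
  ∃ (S : Fin m → Fin m → Set G) (c : ℕ), Rep S H c ∧ 2 ≤ c ∧ 2 * c + 2 < m * Nat.card H

lemma two_mul_card_le_of_notMem [Finite G] {H : Subgroup G} {b : G} (hb : b ∉ H) :
    2 * Nat.card H ≤ Nat.card (H ⊔ Subgroup.zpowers b : Subgroup G) := by
  have hle : H ≤ H ⊔ Subgroup.zpowers b := le_sup_left
  obtain ⟨k, hk⟩ := Subgroup.card_dvd_of_le hle
  have h0 : 0 < Nat.card (H ⊔ Subgroup.zpowers b : Subgroup G) := Nat.card_pos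
  have hk0 : k ≠ 0 := by rintro rfl; omega
  have hk1 : k ≠ 1 := by
    rintro rfl
    have := Subgroup.eq_of_le_of_card_ge hle (by omega)
    rw [this] at hb
    exact hb ((le_sup_right : Subgroup.zpowers b ≤ _) (Subgroup.mem_zpowers b))
  rw [hk, mul_comm]
  exact Nat.mul_le_mul_left _ (by omega)

lemma Rep.good_adjoin [Finite G] {T : Fin m → Fin m → Set G} {H : Subgroup G} {d : ℕ}
    (hm : 1 ≤ m) (h : Rep T H d) (tr : Transit T) (lk : Linked T H) (hd : 1 ≤ d)
    (hd' : d + 2 < m * Nat.card H) {b : G} (hb : b ∉ H) :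
    Good m (H ⊔ Subgroup.zpowers b) := by
  refine ⟨_, _, h.adjoin hm tr lk hb, by omega, ?_⟩
  have := Nat.mul_le_mul_left m (two_mul_card_le_of_notMem hb)
  rw [mul_left_comm] at this
  omega

lemma Good.sup_zpowers [Finite G] {H : Subgroup G} (hm : 1 ≤ m) (h : Good m H) {b : G}
    (hb : b ∉ H) : Good m (H ⊔ Subgroup.zpowers b) := by
  obtain ⟨S, c, hS, hc, hc'⟩ := h
  have hd : m * Nat.card H < 2 * (m * Nat.card H - 1 - c) := by omega
  exact hS.compl.good_adjoin hm (hS.compl.transit_of_dense hd) (hS.compl.linked_of_dense hd)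
    (by omega) (by omega) hb

lemma Good.hasMDRR [Finite G] {H : Subgroup G} (hm : 1 ≤ m) (h : Good m H) : HasMDRR G m := by
  obtain ⟨K, hK, hmax⟩ := (Set.toFinite {K : Subgroup G | Good m K}).exists_maximal ⟨H, h⟩
  have htop : K = ⊤ := by
    by_contra hne
    obtain ⟨b, hb⟩ : ∃ b, b ∉ K := by
      by_contra! hall
      exact hne (eq_top_iff.2 fun x _ => hall x)
    have := hmax (Good.sup_zpowers hm hK hb) le_sup_left
    exact hb (this ((le_sup_right : Subgroup.zpowers b ≤ _) (Subgroup.mem_zpowers b)))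
  subst htop
  obtain ⟨S, c, hS, -⟩ := hK
  exact hS.hasMDRR hm

end MCayley

namespace MCayley

lemma ncard_label_mem_family {m : ℕ} {α : Type} [Finite α] (F : Fin m → Set α) :
    {p : Fin m × α | p.2 ∈ F p.1}.ncard = ∑ j, (F j).ncard := by
  classical
  have := Fintype.ofFinite α
  let e : {p : Fin m × α | p.2 ∈ F p.1} ≃ Σ j, F j :=
    { toFun := fun p => ⟨p.1.1, p.1.2, p.2⟩
      invFun := fun p => ⟨(p.1, p.2.1), p.2.2⟩
      left_inv := fun _ => rfl
      right_inv := fun _ => rfl }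
  rw [← Nat.card_coe_set_eq, Nat.card_congr e, Nat.card_sigma]
  exact Finset.sum_congr rfl fun j _ => Nat.card_coe_set_eq _

variable {G : Type} [Group G] {m : ℕ}

/-- Undirected paths `0, …, m - 1`, with an arc from start to end and an arc from the end of the
path at `x` to the start of the path at `x * a`. -/
def pathFamily (m : ℕ) (a : G) : Fin m → Fin m → Set G := fun i j =>
  {x | (x = 1 ∧ (j.val = i.val + 1 ∨ i.val = j.val + 1 ∨ (i.val = 0 ∧ j.val + 1 = m))) ∨
    (x = a ∧ i.val + 1 = m ∧ j.val = 0)}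

lemma arc_pathFamily_symm {a : G} (ha : a ≠ 1) (hm : 3 ≤ m) {i j : Fin m} {x y : G} :
    (Arc (pathFamily m a) (i, x) (j, y) ∧ Arc (pathFamily m a) (j, y) (i, x)) ↔
      x = y ∧ (j.val = i.val + 1 ∨ i.val = j.val + 1) := by
  have hi := i.2
  have hj := j.2
  simp only [Arc, pathFamily, Set.mem_ofPred_eq, inv_mul_eq_one]
  constructor
  · rintro ⟨⟨rfl, h1⟩ | ⟨h1, h2, h3⟩, ⟨h4, h5⟩ | ⟨h4, h5, h6⟩⟩
    · exact ⟨rfl, by omega⟩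
    · simp at h4
      exact absurd h4.symm ha
    · subst h4
      simp at h1
      exact absurd h1.symm ha
    · omega
  · rintro ⟨rfl, h⟩
    exact ⟨Or.inl ⟨rfl, by omega⟩, Or.inl ⟨rfl, by omega⟩⟩

lemma rigid_pathFamily [Finite G] {a : G} (ha : a ≠ 1) (hm : 3 ≤ m) :
    Rigid (pathFamily m a) (Subgroup.zpowers a) := by
  intro f hf
  set H := Subgroup.zpowers a
  have hsym : ∀ i j x y, x ∈ H → y ∈ H →
      (((f (i, x)).2 = (f (j, y)).2 ∧
        ((f (j, y)).1.val = (f (i, x)).1.val + 1 ∨ (f (i, x)).1.val = (f (j, y)).1.val + 1)) ↔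
        x = y ∧ (j.val = i.val + 1 ∨ i.val = j.val + 1)) := by
    intro i j x y hx hy
    rw [← arc_pathFamily_symm ha hm, ← arc_pathFamily_symm ha hm]
    exact and_congr (hf.arc _ _ hx hy) (hf.arc _ _ hy hx)
  let i₀ : Fin m := ⟨0, by omega⟩
  let l : Fin m := ⟨m - 1, by omega⟩
  have hend : ∀ x ∈ H, (f (i₀, x)).1.val = 0 ∨ (f (i₀, x)).1.val = m - 1 := by
    intro x hx
    by_contra! hne
    have hlt := (f (i₀, x)).1.2
    have key : ∀ k : Fin m, (k.val = (f (i₀, x)).1.val + 1 ∨ (f (i₀, x)).1.val = k.val + 1) →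
        (k, (f (i₀, x)).2) = f (⟨1, by omega⟩, x) := by
      intro k hk
      obtain ⟨⟨j, y⟩, hy, e⟩ := hf.exists_eq (k, (f (i₀, x)).2) (hf.maps _ hx)
      have h1 := (hsym i₀ j x y hx hy).1 (by rw [e]; exact ⟨rfl, hk⟩)
      have h2 : j = ⟨1, by omega⟩ := Fin.ext (by
        have := h1.2
        show j.val = 1
        simp only [i₀] at this
        omega)
      rw [← e, h1.1, h2]
    have h1 := key ⟨(f (i₀, x)).1.val + 1, by omega⟩ (Or.inl rfl)
    have h2 := key ⟨(f (i₀, x)).1.val - 1, by omega⟩ (Or.inr (by show _ = _ - 1 + 1; omega))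
    have h3 := congrArg (fun p => p.1.val) (h1.trans h2.symm)
    simp only at h3
    omega
  have hstep : ∀ x ∈ H, ∀ n (hn : n < m), (f (⟨n, hn⟩, x)).2 = (f (i₀, x)).2 ∧
      (f (⟨n, hn⟩, x)).1.val = if (f (i₀, x)).1.val = 0 then n else m - 1 - n := by
    intro x hx n
    induction n using Nat.strong_induction_on with
    | _ n ih =>
      intro hn
      rcases n with _ | _ | n
      · refine ⟨rfl, ?_⟩
        have := hend x hx
        simp only [i₀] at this ⊢
        split_ifs <;> omega
      · have h1 := (hsym i₀ ⟨1, hn⟩ x x hx hx).2 ⟨rfl, Or.inl rfl⟩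
        have := hend x hx
        have hlt := (f (⟨1, hn⟩, x)).1.2
        refine ⟨h1.1.symm, ?_⟩
        show (f (⟨1, hn⟩, x)).1.val = if (f (i₀, x)).1.val = 0 then 1 else m - 1 - 1
        split_ifs <;> omega
      · obtain ⟨h1, h2⟩ := ih (n + 1) (by omega) (by omega)
        obtain ⟨h3, h4⟩ := ih n (by omega) (by omega)
        have h5 := (hsym ⟨n + 1, by omega⟩ ⟨n + 2, hn⟩ x x hx hx).2 ⟨rfl, Or.inl rfl⟩
        have h6 : (f (⟨n + 2, hn⟩, x)).1.val ≠ (f (⟨n, by omega⟩, x)).1.val := by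
          intro e
          have := hf.inj (⟨n + 2, hn⟩, x) (⟨n, by omega⟩, x) hx hx
            (Prod.ext (Fin.ext e) (h5.1.symm.trans (h1.trans h3.symm)))
          simp at this
        have hlt := (f (⟨n + 2, hn⟩, x)).1.2
        refine ⟨h5.1.symm.trans h1, ?_⟩
        show (f (⟨n + 2, hn⟩, x)).1.val = _
        split_ifs at * <;> omega
  have hzero : ∀ x ∈ H, (f (i₀, x)).1.val = 0 := by
    intro x hx
    by_contra hne
    have h1 := (hend x hx).resolve_left hne
    have h2 := hstep x hx (m - 1) (by omega)
    rw [if_neg hne] at h2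
    have h3 : Arc (pathFamily m a) (i₀, x) (l, x) :=
      Or.inl ⟨by simp, Or.inr (Or.inr ⟨rfl, by simp only [l]; omega⟩)⟩
    rw [← hf.arc _ _ hx hx] at h3
    simp only [Arc, pathFamily, Set.mem_ofPred_eq, l, h2.1, h2.2, h1, inv_mul_cancel] at h3
    rcases h3 with ⟨-, h3⟩ | ⟨h3, -⟩
    · omega
    · exact ha h3.symm
  have hval : ∀ x ∈ H, ∀ i, f (i, x) = (i, (f (i₀, x)).2) := by
    intro x hx i
    obtain ⟨h1, h2⟩ := hstep x hx i.val i.2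
    rw [if_pos (hzero x hx)] at h2
    exact Prod.ext (Fin.ext h2) h1
  refine exists_translation (L := {a}) (Subgroup.zpowers_eq_closure a).symm
    (hf.maps (i₀, 1) H.one_mem) hval ?_
  intro k hk x hx
  rw [Set.mem_singleton_iff.1 hk]
  have hxa := H.mul_mem hx (Subgroup.mem_zpowers a)
  have h1 : Arc (pathFamily m a) (l, x) (i₀, x * a) :=
    Or.inr ⟨by simp, by simp only [l]; omega, rfl⟩
  rw [← hf.arc _ _ hx hxa, hval x hx, hval _ hxa] at h1
  simp only [Arc, pathFamily, Set.mem_ofPred_eq, l, i₀] at h1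
  rcases h1 with ⟨-, h1⟩ | ⟨h1, -⟩
  · omega
  · exact inv_mul_eq_iff_eq_mul.1 h1

lemma rep_pathFamily [Finite G] {a : G} (ha : a ≠ 1) (hm : 3 ≤ m) :
    Rep (pathFamily m a) (Subgroup.zpowers a) 2 where
  supp := by
    rintro i j x (⟨rfl, -⟩ | ⟨rfl, -⟩)
    · exact one_mem _
    · exact Subgroup.mem_zpowers _
  loopless := by
    rintro i (⟨-, h⟩ | ⟨h, -⟩)
    · omega
    · exact ha h.symm
  outdeg := by
    intro i
    have hi := i.2
    rw [Set.ncard_eq_two]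
    by_cases h0 : i.val = 0
    · refine ⟨(⟨1, by omega⟩, 1), (⟨m - 1, by omega⟩, 1), by simp; omega, ?_⟩
      ext ⟨j, x⟩
      have hj := j.2
      simp only [pathFamily, Set.mem_ofPred_eq, Set.mem_insert_iff, Set.mem_singleton_iff,
        Prod.mk.injEq, Fin.ext_iff]
      by_cases hx : x = 1
      · simp [hx, ha.symm]; omega
      · simp [hx]; omega
    · by_cases hl : i.val + 1 = m
      · refine ⟨(⟨m - 2, by omega⟩, 1), (⟨0, by omega⟩, a), by simp [ha.symm], ?_⟩
        ext ⟨j, x⟩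
        have hj := j.2
        simp only [pathFamily, Set.mem_ofPred_eq, Set.mem_insert_iff, Set.mem_singleton_iff,
          Prod.mk.injEq, Fin.ext_iff]
        by_cases hx : x = 1
        · simp [hx, ha.symm]; omega
        · simp [hx]; tauto
      · refine ⟨(⟨i.val + 1, by omega⟩, 1), (⟨i.val - 1, by omega⟩, 1), by simp; omega, ?_⟩
        ext ⟨j, x⟩
        have hj := j.2
        simp only [pathFamily, Set.mem_ofPred_eq, Set.mem_insert_iff, Set.mem_singleton_iff,
          Prod.mk.injEq, Fin.ext_iff]
        by_cases hx : x = 1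
        · simp [hx, ha.symm]; omega
        · simp [hx]; tauto
  indeg := by
    intro i
    have hi := i.2
    rw [Set.ncard_eq_two]
    by_cases h0 : i.val = 0
    · refine ⟨(⟨1, by omega⟩, 1), (⟨m - 1, by omega⟩, a), by simp [ha.symm], ?_⟩
      ext ⟨j, x⟩
      have hj := j.2
      simp only [pathFamily, Set.mem_ofPred_eq, Set.mem_insert_iff, Set.mem_singleton_iff,
        Prod.mk.injEq, Fin.ext_iff]
      by_cases hx : x = 1
      · simp [hx, ha.symm]; omega
      · by_cases hxa : x = a <;> simp [hx, hxa, ha, h0]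
        omega
    · by_cases hl : i.val + 1 = m
      · refine ⟨(⟨m - 2, by omega⟩, 1), (⟨0, by omega⟩, 1), by simp; omega, ?_⟩
        ext ⟨j, x⟩
        have hj := j.2
        simp only [pathFamily, Set.mem_ofPred_eq, Set.mem_insert_iff, Set.mem_singleton_iff,
          Prod.mk.injEq, Fin.ext_iff]
        by_cases hx : x = 1
        · simp [hx, ha.symm]; omega
        · simp [hx]; omega
      · refine ⟨(⟨i.val + 1, by omega⟩, 1), (⟨i.val - 1, by omega⟩, 1), by simp; omega, ?_⟩
        ext ⟨j, x⟩
        have hj := j.2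
        simp only [pathFamily, Set.mem_ofPred_eq, Set.mem_insert_iff, Set.mem_singleton_iff,
          Prod.mk.injEq, Fin.ext_iff]
        by_cases hx : x = 1
        · simp [hx, ha.symm]; omega
        · simp [hx]; omega
  rigid := rigid_pathFamily ha hm

lemma rigid_of_stabilizer {S : Fin m → Fin m → Set G} {H : Subgroup G} {L : Set G}
    (hL : Subgroup.closure L = H) (i₀ : Fin m)
    (h0 : ∀ f, LocalAut S H f → (f (i₀, 1)).1 = i₀)
    (h1 : ∀ f, LocalAut S H f → f (i₀, 1) = (i₀, 1) →
      (∀ i, f (i, 1) = (i, 1)) ∧ ∀ l ∈ L, ∃ i, f (i, l) = (i, l)) : Rigid S H := by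
  intro f hf
  have hconj : ∀ x ∈ H, LocalAut S H
      (fun p => ((f (p.1, x * p.2)).1, (f (i₀, x)).2⁻¹ * (f (p.1, x * p.2)).2)) :=
    fun x hx => hf.conj_translate le_rfl hx fun i h hh =>
      H.mul_mem (H.inv_mem (hf.maps (i₀, x) hx)) (hf.maps (i, x * h) (H.mul_mem hx hh))
  have hpart : ∀ x ∈ H, (f (i₀, x)).1 = i₀ := by
    intro x hx
    simpa using h0 _ (hconj x hx)
  have hfix := fun x hx => h1 _ (hconj x hx) (by simp [hpart x hx])
  have hval : ∀ x ∈ H, ∀ i, f (i, x) = (i, (f (i₀, x)).2) := by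
    intro x hx i
    have h := (hfix x hx).1 i
    simp only [mul_one, Prod.mk.injEq, inv_mul_eq_one] at h
    exact Prod.ext h.1 h.2.symm
  refine exists_translation hL (hf.maps (i₀, 1) H.one_mem) hval fun l hl x hx => ?_
  obtain ⟨i, h⟩ := (hfix x hx).2 l hl
  simp only [Prod.mk.injEq, inv_mul_eq_iff_eq_mul] at h
  have hxl : x * l ∈ H := H.mul_mem hx (hL ▸ Subgroup.subset_closure hl)
  rw [hval _ hxl] at h
  exact h.2

/-- A two-part family of valency two in which only the vertices of the first part have adjacent
out-neighbours. -/
def pairFamily (a c : G) : Fin 2 → Fin 2 → Set G := ![![{a}, {1}], ![{a}, {c}]]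

lemma arc_pairFamily_zero {a c x : G} {v : Fin 2 × G} :
    Arc (pairFamily a c) (0, x) v ↔ v = (0, x * a) ∨ v = (1, x) := by
  obtain ⟨j, y⟩ := v
  fin_cases j <;> simp [Arc, pairFamily, inv_mul_eq_iff_eq_mul]

lemma arc_pairFamily_one {a c x : G} {v : Fin 2 × G} :
    Arc (pairFamily a c) (1, x) v ↔ v = (0, x * a) ∨ v = (1, x * c) := by
  obtain ⟨j, y⟩ := v
  fin_cases j <;> simp [Arc, pairFamily, inv_mul_eq_iff_eq_mul]

lemma rep_pairFamily [Finite G] {a c : G} (ha : a ≠ 1) (hc : c ≠ 1) (hac : a ≠ c) :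
    Rep (pairFamily a c) (Subgroup.closure {a, c}) 2 where
  supp := by
    have h1 : a ∈ Subgroup.closure {a, c} := Subgroup.subset_closure (by simp)
    have h2 : c ∈ Subgroup.closure {a, c} := Subgroup.subset_closure (by simp)
    intro i j
    fin_cases i <;> fin_cases j <;> simp [pairFamily, h1, h2]
  loopless := by
    intro i
    fin_cases i <;> simp [pairFamily, ha.symm, hc.symm]
  outdeg := by
    intro i
    rw [ncard_label_mem_family]
    fin_cases i <;> simp [pairFamily]
  indeg := by
    intro i
    rw [ncard_label_mem_family fun j => pairFamily a c j i]
    fin_cases i <;> simp [pairFamily]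
  rigid := by
    set H := Subgroup.closure {a, c}
    have haH : a ∈ H := Subgroup.subset_closure (by simp)
    have hcH : c ∈ H := Subgroup.subset_closure (by simp)
    have hpart : ∀ f, LocalAut (pairFamily a c) H f → ∀ x ∈ H, (f (0, x)).1 = 0 := by
      intro f hf x hx
      have hxa := H.mul_mem hx haH
      have h1 := (hf.arc (0, x) (1, x) hx hx).2 (arc_pairFamily_zero.2 (Or.inr rfl))
      have h2 := (hf.arc (0, x) (0, x * a) hx hxa).2 (arc_pairFamily_zero.2 (Or.inl rfl))
      have h3 := (hf.arc (1, x) (0, x * a) hx hxa).2 (arc_pairFamily_one.2 (Or.inl rfl))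
      generalize f (1, x) = p at *
      generalize f (0, x * a) = q at *
      generalize f (0, x) = r at *
      obtain ⟨i, y⟩ := r
      fin_cases i
      · rfl
      exfalso
      simp only [Fin.mk_one, arc_pairFamily_one] at h1 h2
      rcases h1 with rfl | rfl <;> rcases h2 with rfl | rfl <;>
        simp only [arc_pairFamily_zero, arc_pairFamily_one] at h3 <;> simp_all
    refine rigid_of_stabilizer rfl 0 (fun f hf => hpart f hf 1 H.one_mem) fun f hf hfix => ?_
    have h1 := (hf.arc (0, 1) (1, 1) H.one_mem H.one_mem).2 (arc_pairFamily_zero.2 (Or.inr rfl))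
    have h2 := (hf.arc (0, 1) (0, a) H.one_mem haH).2
      (arc_pairFamily_zero.2 (Or.inl (by simp)))
    rw [hfix, arc_pairFamily_zero, one_mul] at h1 h2
    have h3 : f (0, a) = (0, a) := h2.resolve_right fun e => by
      have := hpart f hf a haH
      simp [e] at this
    have h4 : f (1, 1) = (1, 1) := h1.resolve_left fun e => by
      have := hf.inj (1, 1) (0, a) H.one_mem haH (e.trans h3.symm)
      simp at this
    have h5 := (hf.arc (1, 1) (1, c) H.one_mem hcH).2 (arc_pairFamily_one.2 (Or.inr (by simp)))
    rw [h4, arc_pairFamily_one, one_mul, one_mul] at h5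
    have h6 : f (1, c) = (1, c) := h5.resolve_left fun e => by
      have := hf.inj (1, c) (0, a) hcH haH (e.trans h3.symm)
      simp at this
    refine ⟨fun i => ?_, ?_⟩
    · fin_cases i
      · exact hfix
      · exact h4
    · rintro l (rfl | rfl)
      · exact ⟨0, h3⟩
      · exact ⟨1, h6⟩

lemma four_le_card_closure_pair [Finite G] {a c : G} (ha : a ≠ 1)
    (hc : c ∉ Subgroup.zpowers a) : 4 ≤ Nat.card (Subgroup.closure {a, c}) := by
  have h1 : Subgroup.closure {a, c} = Subgroup.zpowers a ⊔ Subgroup.zpowers c := by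
    rw [← Set.singleton_union, Subgroup.closure_union, Subgroup.zpowers_eq_closure,
      Subgroup.zpowers_eq_closure]
  have h2 := two_mul_card_le_of_notMem hc
  have h3 : 1 < Nat.card (Subgroup.zpowers a) := by
    rw [Nat.card_zpowers]
    have := orderOf_pos a
    have := mt orderOf_eq_one_iff.1 ha
    omega
  rw [h1]
  omega

lemma exists_ne_one_of_card [Finite G] (hG : 2 ≤ Nat.card G) : ∃ a : G, a ≠ 1 := by
  have : Nontrivial G := Finite.one_lt_card_iff_nontrivial.1 hG
  exact exists_ne 1

lemma zpowers_eq_top_or [Finite G] (a : G) :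
    Subgroup.zpowers a = ⊤ ∨ ∃ c, c ∉ Subgroup.zpowers a := by
  by_contra! h
  exact h.1 (eq_top_iff.2 fun x _ => h.2 x)

lemma hasMDRR_two [Finite G] (hG : 3 ≤ Nat.card G) : HasMDRR G 2 := by
  obtain ⟨a, ha⟩ := exists_ne_one_of_card (G := G) (by omega)
  rcases zpowers_eq_top_or a with htop | ⟨c, hc⟩
  · have hne : a ≠ a⁻¹ := by
      intro h
      have h2 : a ^ 2 = 1 := by rw [sq]; exact mul_eq_one_iff_eq_inv.2 h
      have := orderOf_le_of_pow_eq_one (by norm_num) h2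
      rw [← Nat.card_zpowers, htop, Subgroup.card_top] at this
      omega
    have h := rep_pairFamily ha (inv_ne_one.2 ha) hne
    rw [show Subgroup.closure {a, a⁻¹} = ⊤ from top_le_iff.1 (by
      rw [← htop, Subgroup.zpowers_le]
      exact Subgroup.subset_closure (by simp))] at h
    exact h.hasMDRR (by norm_num)
  · have hc1 : c ≠ 1 := by rintro rfl; exact hc (one_mem _)
    have hac : a ≠ c := by rintro rfl; exact hc (Subgroup.mem_zpowers a)
    have := four_le_card_closure_pair ha hc
    exact Good.hasMDRR (by norm_num) ⟨_, _, rep_pairFamily ha hc1 hac, le_rfl, by omega⟩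

/-- A three-part family of valency two built from two involutions. -/
def tripleFamily (a b : G) : Fin 3 → Fin 3 → Set G :=
  ![![{b}, {1}, ∅], ![∅, {b}, {1}], ![{1}, ∅, {a}]]

lemma rep_tripleFamily [Finite G] {a b : G} (ha : a ≠ 1) (hb : b ≠ 1) (hab : a ≠ b)
    (ha2 : a * a = 1) (hb2 : b * b = 1) :
    Rep (tripleFamily a b) (Subgroup.closure {a, b}) 2 where
  supp := by
    have h1 : a ∈ Subgroup.closure {a, b} := Subgroup.subset_closure (by simp)
    have h2 : b ∈ Subgroup.closure {a, b} := Subgroup.subset_closure (by simp)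
    intro i j
    fin_cases i <;> fin_cases j <;> simp [tripleFamily, h1, h2]
  loopless := by
    intro i
    fin_cases i <;> simp [tripleFamily, ha.symm, hb.symm]
  outdeg := by
    intro i
    rw [ncard_label_mem_family]
    fin_cases i <;> simp [tripleFamily, Fin.sum_univ_three]
  indeg := by
    intro i
    rw [ncard_label_mem_family fun j => tripleFamily a b j i]
    fin_cases i <;> simp [tripleFamily, Fin.sum_univ_three]
  rigid := by
    set H := Subgroup.closure {a, b}
    have haH : a ∈ H := Subgroup.subset_closure (by simp)
    have hbH : b ∈ H := Subgroup.subset_closure (by simp)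
    let t : Fin 3 → G := ![b, b, a]
    have ht : ∀ i, t i ∈ H := by intro i; fin_cases i <;> simp [t, haH, hbH]
    have hai : a⁻¹ = a := inv_eq_of_mul_eq_one_left ha2
    have hbi : b⁻¹ = b := inv_eq_of_mul_eq_one_left hb2
    have hdouble : ∀ u v : Fin 3 × G, Arc (tripleFamily a b) u v ∧ Arc (tripleFamily a b) v u ↔
        v = (u.1, u.2 * t u.1) := by
      rintro ⟨i, x⟩ ⟨j, y⟩
      fin_cases i <;> fin_cases j <;>
        simp [Arc, tripleFamily, t, inv_mul_eq_iff_eq_mul] <;>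
        rintro rfl <;> simp [mul_assoc, ha2, hb2]
    have hsingle : ∀ u v : Fin 3 × G,
        Arc (tripleFamily a b) u v ∧ ¬ Arc (tripleFamily a b) v u ↔ v = (u.1 + 1, u.2) := by
      rintro ⟨i, x⟩ ⟨j, y⟩
      fin_cases i <;> fin_cases j <;>
        simp [Arc, tripleFamily, inv_mul_eq_iff_eq_mul, eq_comm] <;>
        exact fun h => by simpa [hai, hbi] using congrArg (·⁻¹) h
    have hM : ∀ f, LocalAut (tripleFamily a b) H f → ∀ i, ∀ x ∈ H,
        f (i, x * t i) = ((f (i, x)).1, (f (i, x)).2 * t (f (i, x)).1) := by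
      intro f hf i x hx
      have hxt : x * t i ∈ H := H.mul_mem hx (ht i)
      exact (hdouble _ _).1 (by
        rw [hf.arc (i, x) (i, x * t i) hx hxt, hf.arc (i, x * t i) (i, x) hxt hx]
        exact (hdouble _ _).2 rfl)
    have hP : ∀ f, LocalAut (tripleFamily a b) H f → ∀ i, ∀ x ∈ H,
        f (i + 1, x) = ((f (i, x)).1 + 1, (f (i, x)).2) := by
      intro f hf i x hx
      exact (hsingle _ _).1 (by
        rw [hf.arc (i, x) (i + 1, x) hx hx, hf.arc (i + 1, x) (i, x) hx hx]
        exact (hsingle _ _).2 rfl)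
    refine rigid_of_stabilizer rfl 0 (fun f hf => ?_) fun f hf hfix => ?_
    · have h1 := hM f hf 0 1 H.one_mem
      have h2 := hP f hf 0 _ (H.mul_mem H.one_mem (ht 0))
      have h3 := hP f hf 0 1 H.one_mem
      have h4 := hM f hf (0 + 1) 1 H.one_mem
      rw [show t (0 + 1) = t 0 from rfl, h2, h1, h3] at h4
      have h5 := congrArg Prod.snd h4
      simp only [mul_right_inj] at h5
      generalize (f (0, 1)).1 = i at h5
      fin_cases i
      · rfl
      · exact absurd h5.symm hab
      · exact absurd h5 hab
    · have h1 : ∀ i, f (i, 1) = (i, 1) := by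
        have h1 := hP f hf 0 1 H.one_mem
        rw [hfix] at h1
        have h2 := hP f hf (0 + 1) 1 H.one_mem
        rw [h1] at h2
        intro i
        fin_cases i
        · exact hfix
        · exact h1
        · exact h2
      refine ⟨h1, ?_⟩
      rintro l (rfl | rfl)
      · have := hM f hf 2 1 H.one_mem
        rw [h1, one_mul] at this
        exact ⟨2, this⟩
      · have := hM f hf 0 1 H.one_mem
        rw [h1, one_mul] at this
        exact ⟨0, this⟩

lemma hasMDRR_of_three_le [Finite G] (hm : 3 ≤ m) (hG : 2 ≤ Nat.card G) : HasMDRR G m := by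
  by_cases hN : ∃ a : G, a ≠ 1 ∧ 7 ≤ m * orderOf a
  · obtain ⟨a, ha, hma⟩ := hN
    exact Good.hasMDRR (by omega) ⟨_, _, rep_pathFamily ha hm, le_rfl, by
      rw [Nat.card_zpowers]; omega⟩
  push Not at hN
  obtain ⟨a, ha⟩ := exists_ne_one_of_card hG
  have hord : ∀ b : G, b ≠ 1 → orderOf b = 2 ∧ m = 3 := by
    intro b hb
    have h1 := hN b hb
    have h2 := orderOf_pos b
    have h3 := mt orderOf_eq_one_iff.1 hb
    have h4 : orderOf b < 3 := by by_contra!; nlinarith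
    have h5 : orderOf b = 2 := by omega
    exact ⟨h5, by rw [h5] at h1; omega⟩
  obtain rfl := (hord a ha).2
  rcases zpowers_eq_top_or a with htop | ⟨c, hc⟩
  · have h := rep_pathFamily ha hm
    rw [htop] at h
    exact h.hasMDRR (by norm_num)
  · have hc1 : c ≠ 1 := by rintro rfl; exact hc (one_mem _)
    have hac : a ≠ c := by rintro rfl; exact hc (Subgroup.mem_zpowers a)
    have := four_le_card_closure_pair ha hc
    have hsq : ∀ b : G, b ≠ 1 → b * b = 1 := fun b hb => by
      rw [← sq, ← (hord b hb).1, pow_orderOf_eq_one]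
    exact Good.hasMDRR (by norm_num)
      ⟨_, _, rep_tripleFamily ha hc1 hac (hsq a ha) (hsq c hc1), le_rfl, by omega⟩

lemma hasMDRR_of_asymmetric (hG : Nat.card G = 1) (A : Fin m → Fin m → Prop)
    (hl : ∀ i, ¬ A i i) (hout : ∀ i, {j | A i j}.ncard = 2) (hin : ∀ i, {j | A j i}.ncard = 2)
    (hA : ∀ σ : Equiv.Perm (Fin m), IsDigraphAut A σ → ∀ i, σ i = i) : HasMDRR G m := by
  obtain ⟨hs, -⟩ := Nat.card_eq_one_iff_unique.1 hG
  refine ⟨Fin m, inferInstance, A, 1, hl, ⟨2, fun v => ⟨hout v, hin v⟩⟩, fun g u v => Iff.rfl,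
    fun σ hσ => ⟨1, Equiv.ext fun i => (hA σ hσ i).symm⟩, Function.injective_of_subsingleton _,
    fun g _ _ => Subsingleton.elim g 1, id, fun v => ⟨v, ⟨1, rfl⟩, ?_⟩⟩
  rintro y ⟨g, hg⟩
  exact hg

/-- The undirected paths `0, 1, 2` and `3, …, m - 1` together with a directed `4`-cycle through
their end vertices. -/
def twoPaths (m : ℕ) (i j : Fin m) : Prop :=
  j.val = i.val + 1 ∨ (i.val = j.val + 1 ∧ i.val ≠ 3) ∨ (i.val = 0 ∧ j.val = 2) ∨
    (i.val = 3 ∧ j.val + 1 = m) ∨ (i.val + 1 = m ∧ j.val = 0)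

lemma eq_of_twoPaths_aut (hm : 7 ≤ m) {σ : Equiv.Perm (Fin m)}
    (hσ : IsDigraphAut (twoPaths m) σ) (i : Fin m) : σ i = i := by
  have hval : ∀ i j : Fin m, σ i = σ j → i.val = j.val := fun i j h => by rw [σ.injective h]
  have h012 : (σ ⟨0, by omega⟩).val = 0 ∧ (σ ⟨1, by omega⟩).val = 1 ∧
      (σ ⟨2, by omega⟩).val = 2 := by
    have h01 := (hσ ⟨0, by omega⟩ ⟨1, by omega⟩).2 (by simp [twoPaths])
    have h10 := (hσ ⟨1, by omega⟩ ⟨0, by omega⟩).2 (by simp [twoPaths])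
    have h12 := (hσ ⟨1, by omega⟩ ⟨2, by omega⟩).2 (by simp [twoPaths])
    have h21 := (hσ ⟨2, by omega⟩ ⟨1, by omega⟩).2 (by simp [twoPaths])
    have h02 := (hσ ⟨0, by omega⟩ ⟨2, by omega⟩).2 (by simp [twoPaths])
    have h20 := mt (hσ ⟨2, by omega⟩ ⟨0, by omega⟩).1 (by simp [twoPaths]; omega)
    have h0 := (σ ⟨0, by omega⟩).2
    have h1 := (σ ⟨1, by omega⟩).2
    have h2 := (σ ⟨2, by omega⟩).2
    simp only [twoPaths] at *
    omega
  obtain ⟨h0, h1, h2⟩ := h012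
  have h3 : (σ ⟨3, by omega⟩).val = 3 := by
    have h23 := (hσ ⟨2, by omega⟩ ⟨3, by omega⟩).2 (by simp [twoPaths])
    have h32 := mt (hσ ⟨3, by omega⟩ ⟨2, by omega⟩).1 (by simp [twoPaths]; omega)
    have := (σ ⟨3, by omega⟩).2
    simp only [twoPaths] at *
    omega
  have hrest : ∀ n (hn : n + 3 < m), (σ ⟨n + 3, hn⟩).val = n + 3 := by
    intro n
    induction n using Nat.strong_induction_on with
    | _ n ih =>
      intro hn
      rcases n with _ | n
      · exact h3
      have hp := ih n (by omega) (by omega)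
      have h34 := (hσ ⟨n + 3, by omega⟩ ⟨n + 1 + 3, hn⟩).2 (by simp [twoPaths])
      have h43 := (hσ ⟨n + 1 + 3, hn⟩ ⟨n + 3, by omega⟩).2 (by simp [twoPaths])
      have := (σ ⟨n + 1 + 3, hn⟩).2
      rcases n with _ | n
      · simp only [twoPaths] at *
        omega
      · have hp' := ih n (by omega) (by omega)
        have hne : (σ ⟨n + 1 + 1 + 3, hn⟩).val ≠ (σ ⟨n + 3, by omega⟩).val := fun e => by
          have := hval _ _ (Fin.ext e)
          simp only at this
          omega
        simp only [twoPaths] at *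
        omega
  obtain ⟨i, hi⟩ := i
  refine Fin.ext ?_
  rcases i with _ | _ | _ | n
  · exact h0
  · exact h1
  · exact h2
  · exact hrest n hi

lemma ncard_eq_two_of_val {s : Set (Fin m)} (a b : ℕ) (ha : a < m) (hb : b < m) (hab : a ≠ b)
    (hs : ∀ j, j ∈ s ↔ j.val = a ∨ j.val = b) : s.ncard = 2 := by
  rw [Set.ncard_eq_two]
  refine ⟨⟨a, ha⟩, ⟨b, hb⟩, by simpa using hab, ?_⟩
  ext j
  simp [hs, Fin.ext_iff]

lemma hasMDRR_trivial_of_seven_le (hG : Nat.card G = 1) (hm : 7 ≤ m) : HasMDRR G m := by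
  refine hasMDRR_of_asymmetric hG (twoPaths m) (fun i => ?_) (fun i => ?_) (fun i => ?_)
    fun σ hσ => eq_of_twoPaths_aut hm hσ
  · simp only [twoPaths]
    omega
  · refine ncard_eq_two_of_val
      (if i.val = 0 then 1 else if i.val = 3 then 4 else i.val - 1)
      (if i.val = 0 then 2 else if i.val = 3 then m - 1 else if i.val + 1 = m then 0
        else i.val + 1) ?_ ?_ ?_ fun j => ?_
    · split_ifs <;> omega
    · split_ifs <;> omega
    · split_ifs <;> omega
    · have := j.2
      simp only [twoPaths, Set.mem_ofPred_eq]
      split_ifs <;> omega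
  · refine ncard_eq_two_of_val
      (if i.val = 0 then 1 else if i.val = 2 then 0 else i.val - 1)
      (if i.val = 0 then m - 1 else if i.val = 2 then 1 else if i.val + 1 = m then 3
        else i.val + 1) ?_ ?_ ?_ fun j => ?_
    · split_ifs <;> omega
    · split_ifs <;> omega
    · split_ifs <;> omega
    · have := j.2
      simp only [twoPaths, Set.mem_ofPred_eq]
      split_ifs <;> omega

/-- The arcs of an asymmetric digraph of valency two on six vertices. -/
def sixArcs : List (Fin 6 × Fin 6) :=
  [(0, 1), (0, 2), (1, 0), (1, 2), (2, 3), (2, 4), (3, 0), (3, 5), (4, 3), (4, 5), (5, 1), (5, 4)]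

lemma hasMDRR_trivial_six (hG : Nat.card G = 1) : HasMDRR G 6 := by
  refine hasMDRR_of_asymmetric hG (fun i j => (i, j) ∈ sixArcs) (by decide) (fun i => ?_)
    (fun i => ?_) fun σ hσ => ?_
  · rw [Set.ncard_eq_toFinset_card']
    revert i
    decide
  · rw [Set.ncard_eq_toFinset_card']
    revert i
    decide
  · have arc : ∀ i j, (i, j) ∈ sixArcs → (σ i, σ j) ∈ sixArcs := fun i j => (hσ i j).2
    have h2 : σ 2 = 2 := (by decide : ∀ x y z, (y, z) ∈ sixArcs → (z, y) ∈ sixArcs →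
      (y, x) ∈ sixArcs → (z, x) ∈ sixArcs → x = 2) _ _ _ (arc 0 1 (by decide))
      (arc 1 0 (by decide)) (arc 0 2 (by decide)) (arc 1 2 (by decide))
    have h34 : σ 3 = 3 ∧ σ 4 = 4 := (by decide : ∀ x y, (2, x) ∈ sixArcs → (2, y) ∈ sixArcs →
      (y, x) ∈ sixArcs → x = 3 ∧ y = 4) _ _ (h2 ▸ arc 2 3 (by decide))
      (h2 ▸ arc 2 4 (by decide)) (arc 4 3 (by decide))
    have h5 : σ 5 = 5 := (by decide : ∀ x, (3, x) ∈ sixArcs → (4, x) ∈ sixArcs → x = 5) _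
      (h34.1 ▸ arc 3 5 (by decide)) (h34.2 ▸ arc 4 5 (by decide))
    have h0 : σ 0 = 0 := (by decide : ∀ x, (3, x) ∈ sixArcs → (x, 2) ∈ sixArcs → x = 0) _
      (h34.1 ▸ arc 3 0 (by decide)) (h2 ▸ arc 0 2 (by decide))
    have h1 : σ 1 = 1 := (by decide : ∀ x, (5, x) ∈ sixArcs → (x, 2) ∈ sixArcs → x = 1) _
      (h5 ▸ arc 5 1 (by decide)) (h2 ▸ arc 1 2 (by decide))
    intro i
    fin_cases i
    exacts [h0, h1, h2, h34.1, h34.2, h5]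

lemma hasMDRR_trivial (hG : Nat.card G = 1) (hm : 6 ≤ m) : HasMDRR G m := by
  rcases hm.eq_or_lt with rfl | hm
  · exact hasMDRR_trivial_six hG
  · exact hasMDRR_trivial_of_seven_le hG hm

end MCayley

namespace MCayley

variable {G : Type} [Group G]

/-- `g` restricts to an automorphism, fixing `1`, of the Cayley digraph of `H` with connection
set `S`. -/
structure CayleyAut (S : Set G) (H : Subgroup G) (g : G → G) : Prop where
  inj : ∀ x ∈ H, ∀ y ∈ H, g x = g y → x = y
  arc : ∀ x ∈ H, ∀ y ∈ H, (g x)⁻¹ * g y ∈ S ↔ x⁻¹ * y ∈ S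
  one : g 1 = 1

lemma CayleyAut.mem {S : Set G} {H : Subgroup G} {g : G → G} (hg : CayleyAut S H g)
    {x : G} (hx : x ∈ H) : g x ∈ S ↔ x ∈ S := by
  simpa [hg.one] using hg.arc 1 H.one_mem x hx

lemma CayleyAut.mem_inv {S : Set G} {H : Subgroup G} {g : G → G} (hg : CayleyAut S H g)
    {x : G} (hx : x ∈ H) : (g x)⁻¹ ∈ S ↔ x⁻¹ ∈ S := by
  simpa [hg.one] using hg.arc x hx 1 H.one_mem

lemma rep_cayley [Finite G] {S : Set G} {H : Subgroup G} (hS : Subgroup.closure S = H)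
    (h1 : (1 : G) ∉ S) (hfix : ∀ g, CayleyAut S H g → ∀ l ∈ S, g l = l) :
    Rep (fun _ _ : Fin 1 => S) H S.ncard where
  supp _ _ := hS ▸ Subgroup.subset_closure
  loopless _ := h1
  outdeg i := by
    rw [ncard_label_mem_family fun _ => S]
    simp
  indeg i := by
    rw [ncard_label_mem_family fun _ => S]
    simp
  rigid := by
    refine rigid_of_stabilizer hS 0 (fun f _ => Subsingleton.elim _ _) fun f hf hfix1 => ?_
    refine ⟨fun i => by rw [Subsingleton.elim i 0, hfix1], fun l hl => ⟨0, ?_⟩⟩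
    refine Prod.ext (Subsingleton.elim _ _) (hfix (fun x => (f (0, x)).2) ⟨?_, ?_, ?_⟩ l hl)
    · intro x hx y hy e
      have := hf.inj (0, x) (0, y) hx hy (Prod.ext (Subsingleton.elim _ _) e)
      exact congrArg Prod.snd this
    · intro x hx y hy
      exact hf.arc (0, x) (0, y) hx hy
    · rw [hfix1]

lemma hasMDRR_one_of_cyclic [Finite G] {a : G} (htop : Subgroup.zpowers a = ⊤) :
    HasMDRR G 1 := by
  by_cases ha : a = 1
  · subst ha
    refine (rep_cayley (S := ∅) (H := ⊤) ?_ (by simp) (by simp)).hasMDRR le_rfl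
    rw [Subgroup.closure_empty, ← htop, Subgroup.zpowers_one_eq_bot]
  · refine (rep_cayley (S := {a}) (H := ⊤) ?_ (by simpa using Ne.symm ha) ?_).hasMDRR le_rfl
    · rw [← Subgroup.zpowers_eq_closure, htop]
    · intro g hg l hl
      rw [Set.mem_singleton_iff] at hl
      subst hl
      exact (hg.mem (Subgroup.mem_top l)).2 rfl

lemma rep_singleton_zpowers [Finite G] {a : G} (ha : a ≠ 1) :
    Rep (fun _ _ : Fin 1 => {a}) (Subgroup.zpowers a) 1 := by
  have := rep_cayley (S := {a}) (H := Subgroup.zpowers a)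
    (Subgroup.zpowers_eq_closure a).symm (by simpa using ha.symm) (by
      intro g hg l hl
      rw [Set.mem_singleton_iff] at hl
      subst hl
      exact (hg.mem (Subgroup.mem_zpowers l)).2 rfl)
  rwa [Set.ncard_singleton] at this

lemma good_of_seven_le_orderOf [Finite G] {a : G} (ha : 7 ≤ orderOf a) :
    Good 1 (Subgroup.zpowers a) := by
  have hpow : ∀ n, n < 7 → a ^ n = 1 → n = 0 := fun n hn h => by
    by_contra hne
    have := orderOf_le_of_pow_eq_one (by omega) h
    omega
  have h1 : a ≠ 1 := fun h => by simpa using hpow 1 (by norm_num) (by simpa using h)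
  have h2 : a * a ≠ 1 := fun h => by simpa using hpow 2 (by norm_num) (by rw [sq, h])
  have h3 : a * a * a ≠ 1 := fun h => by simpa using hpow 3 (by norm_num) (by rw [pow_succ, sq, h])
  have haH := Subgroup.mem_zpowers a
  have haaH := (Subgroup.zpowers a).mul_mem haH haH
  have hne : a ≠ a * a := by simpa using h1
  refine ⟨_, _, rep_cayley (S := {a, a * a}) ?_ ?_ ?_, (Set.ncard_pair hne).ge, ?_⟩
  · refine le_antisymm ?_ ?_
    · rw [Subgroup.closure_le]
      rintro x (rfl | rfl)
      exacts [haH, haaH]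
    · rw [Subgroup.zpowers_le]
      exact Subgroup.subset_closure (by simp)
  · simp [h1.symm, h2.symm]
  · intro g hg
    have e1 := (hg.mem haH).2 (by simp)
    have e2 := (hg.mem haaH).2 (by simp)
    have e3 := (hg.arc a haH (a * a) haaH).2 (by simp)
    have e4 : g a ≠ g (a * a) := fun e => hne (hg.inj _ haH _ haaH e)
    have e5 : ¬ (g a = a * a ∧ g (a * a) = a) := by
      rintro ⟨e, e'⟩
      rw [e, e'] at e3
      rcases e3 with e3 | e3
      · simp [mul_assoc] at e3
        exact h2 (mul_eq_one_iff_inv_eq.2 e3)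
      · simp [mul_assoc] at e3
        exact h3 (by rw [mul_assoc]; exact mul_eq_one_iff_inv_eq.2 e3)
    simp only [Set.mem_insert_iff, Set.mem_singleton_iff] at e1 e2
    rintro l (rfl | rfl) <;> grind
  · rw [Set.ncard_pair hne, Nat.card_zpowers]
    omega

lemma rep_pair [Finite G] {a b : G} (ha : a * a ≠ 1) (hb : b ≠ 1) (hb2 : b * b = 1) :
    Rep (fun _ _ : Fin 1 => {a, b}) (Subgroup.closure {a, b}) 2 := by
  have haH : a ∈ Subgroup.closure {a, b} := Subgroup.subset_closure (by simp)
  have hbH : b ∈ Subgroup.closure {a, b} := Subgroup.subset_closure (by simp)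
  have ha1 : a ≠ 1 := by rintro rfl; simp at ha
  have hab : a ≠ b := by rintro rfl; exact ha hb2
  have hbi : b⁻¹ = b := inv_eq_of_mul_eq_one_left hb2
  rw [← Set.ncard_pair hab]
  refine rep_cayley rfl (by simp [ha1.symm, hb.symm]) fun g hg => ?_
  have e1 := (hg.mem haH).2 (by simp)
  have e2 := (hg.mem hbH).2 (by simp)
  have e3 := (hg.mem_inv hbH).2 (by simp [hbi])
  have e4 : g a ≠ g b := fun e => hab (hg.inj _ haH _ hbH e)
  have e5 : g b ≠ a := by
    intro e
    rw [e] at e3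
    rcases e3 with e3 | e3
    · exact ha (mul_eq_one_iff_inv_eq.2 e3)
    · exact hab (by rw [← inv_inv a, e3, hbi])
  simp only [Set.mem_insert_iff, Set.mem_singleton_iff] at e1 e2
  rintro l (rfl | rfl) <;> grind

lemma good_closure_pair [Finite G] {a b : G} (ha : a * a ≠ 1) (hb : b ≠ 1) (hb2 : b * b = 1)
    (hcard : 7 ≤ Nat.card (Subgroup.closure {a, b})) : Good 1 (Subgroup.closure {a, b}) :=
  ⟨_, _, rep_pair ha hb hb2, le_rfl, by omega⟩

/-- The arc `a → a * b` is contained in the digraph induced on `{a, b, a * b}`; under the given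
restrictions on the remaining arcs this induced digraph is asymmetric. -/
lemma rep_triple [Finite G] {a b : G} (ha : a ≠ 1) (hb : b ≠ 1) (hab : a ≠ b)
    (hab1 : a * b ≠ 1) (h1 : a⁻¹ * b ∉ ({a, b, a * b} : Set G))
    (h2 : b⁻¹ * a ∉ ({a, b, a * b} : Set G)) (h3 : (a * b)⁻¹ * a ∉ ({a, b, a * b} : Set G))
    (h4 : b⁻¹ * (a * b) ∉ ({a, b, a * b} : Set G)) :
    Rep (fun _ _ : Fin 1 => {a, b, a * b}) (Subgroup.closure {a, b, a * b}) 3 := by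
  have haH : a ∈ Subgroup.closure {a, b, a * b} := Subgroup.subset_closure (by simp)
  have hbH : b ∈ Subgroup.closure {a, b, a * b} := Subgroup.subset_closure (by simp)
  have hcH := Subgroup.mul_mem _ haH hbH
  have hac : a ≠ a * b := by simpa using hb
  have hbc : b ≠ a * b := by simpa using ha
  have h5 : a⁻¹ * (a * b) ∈ ({a, b, a * b} : Set G) := by simp
  have hcard : ({a, b, a * b} : Set G).ncard = 3 :=
    Set.ncard_eq_three.2 ⟨a, b, a * b, hab, hac, hbc, rfl⟩
  rw [← hcard]
  refine rep_cayley rfl (by simp [ha.symm, hb.symm, hab1.symm]) fun g hg => ?_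
  have e1 := (hg.mem haH).2 (by simp)
  have e2 := (hg.mem hbH).2 (by simp)
  have e3 := (hg.mem hcH).2 (by simp)
  have i1 : g a ≠ g b := fun e => hab (hg.inj _ haH _ hbH e)
  have i2 : g a ≠ g (a * b) := fun e => hac (hg.inj _ haH _ hcH e)
  have i3 : g b ≠ g (a * b) := fun e => hbc (hg.inj _ hbH _ hcH e)
  have a1 := hg.arc a haH b hbH
  have a2 := hg.arc b hbH a haH
  have a3 := hg.arc _ hcH a haH
  have a4 := hg.arc b hbH _ hcH
  have a5 := hg.arc a haH _ hcH
  have a6 := hg.arc _ hcH _ hbH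
  intro l hl
  simp only [Set.mem_insert_iff, Set.mem_singleton_iff] at e1 e2 e3 hl
  generalize ({a, b, a * b} : Set G) = S at h1 h2 h3 h4 h5 a1 a2 a3 a4 a5 a6
  simp only [h1, h2, h3, h4, h5, iff_true, iff_false] at a1 a2 a3 a4 a5
  rcases hl with rfl | rfl | rfl <;> grind

/-- A colour refinement of `c` with respect to the digraph `R`. -/
def refine {k : ℕ} (R : Fin k → Fin k → Bool) (c : Fin k → ℕ) (x : Fin k) : ℕ :=
  (c x + ∑ y, ((if R x y then c y ^ 2 else 0) + 2 * if R y x then c y ^ 2 else 0)) % 53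

lemma refine_apply_perm {k : ℕ} {R : Fin k → Fin k → Bool} {c : Fin k → ℕ}
    {π : Equiv.Perm (Fin k)} (hπ : ∀ x y, R (π x) (π y) = R x y) (hc : ∀ x, c (π x) = c x)
    (x : Fin k) : refine R c (π x) = refine R c x := by
  rw [refine, refine, ← Equiv.sum_comp π]
  simp only [hπ, hc]

lemma iterate_refine_apply_perm {k : ℕ} {R : Fin k → Fin k → Bool}
    {π : Equiv.Perm (Fin k)} (hπ : ∀ x y, R (π x) (π y) = R x y) (n : ℕ) (x : Fin k) :
    (refine R)^[n] (fun _ => 1) (π x) = (refine R)^[n] (fun _ => 1) x := by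
  induction n generalizing x with
  | zero => rfl
  | succ n ih =>
    rw [Function.iterate_succ_apply']
    exact refine_apply_perm hπ ih x

/-- The digraph induced on the elements `s 0, …, s (k - 1)` in the Cayley digraph with this
connection set. -/
def inducedArc {A : Type} [Group A] [DecidableEq A] {k : ℕ} (s : Fin k → A)
    (x y : Fin k) : Bool :=
  decide (∃ l, (s x)⁻¹ * s y = s l)

lemma good_of_refine_injective [Finite G] {A : Type} [Group A] [DecidableEq A] {k : ℕ}
    (s : Fin k → A) (hs : Function.Injective s) (h1 : ∀ i, s i ≠ 1)
    (hgen : ∀ v : A, ∃ i j l, v = s i * s j * s l) (n : ℕ)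
    (hn : Function.Injective ((refine (inducedArc s))^[n] fun _ => 1)) (hk : 2 ≤ k)
    (hcard : 2 * k + 2 < Nat.card A) (φ : A →* G) (hφ : Function.Injective φ) :
    Good 1 φ.range := by
  have hmem : ∀ i, φ (s i) ∈ φ.range := fun i => ⟨s i, rfl⟩
  have hinj : Function.Injective fun i => φ (s i) := hφ.comp hs
  have hcS : (Set.range fun i => φ (s i)).ncard = k := by
    rw [← Set.image_univ, Set.ncard_image_of_injective _ hinj, Set.ncard_univ]
    simp
  have hcG : Nat.card φ.range = Nat.card A := by
    rw [← Nat.card_congr (φ.ofInjective hφ).toEquiv]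
  refine ⟨_, _, rep_cayley (S := Set.range fun i => φ (s i)) ?_ ?_ ?_, by omega, by omega⟩
  · refine le_antisymm ?_ ?_
    · rw [Subgroup.closure_le]
      rintro _ ⟨i, rfl⟩
      exact hmem i
    · rintro _ ⟨v, rfl⟩
      obtain ⟨i, j, l, rfl⟩ := hgen v
      simp only [map_mul]
      have h : ∀ i, φ (s i) ∈ Subgroup.closure (Set.range fun i => φ (s i)) :=
        fun i => Subgroup.subset_closure ⟨i, rfl⟩
      exact mul_mem (mul_mem (h i) (h j)) (h l)
  · rintro ⟨i, hi⟩
    exact h1 i (hφ (by simpa using hi))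
  · intro g hg
    have hex : ∀ i, ∃ j, φ (s j) = g (φ (s i)) := fun i => (hg.mem (hmem i)).2 ⟨i, rfl⟩
    choose p hp using hex
    have hpinj : Function.Injective p := by
      intro i j hij
      have h := hp i
      rw [hij, hp j] at h
      exact hinj (hg.inj _ (hmem j) _ (hmem i) h).symm
    let π := Equiv.ofBijective p (Finite.injective_iff_bijective.1 hpinj)
    have hR : ∀ x y, inducedArc s (π x) (π y) = inducedArc s x y := by
      have key : ∀ x y, (φ (s x))⁻¹ * φ (s y) ∈ (Set.range fun i => φ (s i)) ↔
          ∃ l, (s x)⁻¹ * s y = s l := by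
        intro x y
        rw [Set.mem_range, ← map_inv, ← map_mul]
        exact exists_congr fun l => hφ.eq_iff.trans eq_comm
      intro x y
      refine decide_eq_decide.2 ?_
      rw [← key, ← key, ← hg.arc _ (hmem x) _ (hmem y), ← hp, ← hp]
      rfl
    rintro _ ⟨i, rfl⟩
    have h : p i = i := hn (iterate_refine_apply_perm hR n i)
    rw [← hp, h]

/-- Connection set of a sparse DRR of the elementary abelian group of order `27`. -/
def connThree (i : Fin 6) : Multiplicative (Fin 3 → ZMod 3) :=
  Multiplicative.ofAdd
    (![![1, 1, 0], ![1, 0, 1], ![2, 0, 1], ![1, 1, 1], ![1, 2, 1], ![2, 0, 2]] i)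

/-- Connection set of a sparse DRR of the elementary abelian group of order `32`. -/
def connTwo (i : Fin 13) : Multiplicative (Fin 5 → ZMod 2) :=
  Multiplicative.ofAdd
    (![![1, 0, 0, 0, 0], ![0, 1, 0, 0, 0], ![1, 1, 0, 0, 0], ![0, 0, 1, 0, 0], ![1, 0, 1, 0, 0],
      ![0, 1, 1, 0, 0], ![0, 0, 0, 1, 0], ![1, 0, 1, 1, 0], ![0, 0, 0, 0, 1], ![0, 0, 1, 0, 1],
      ![1, 1, 0, 1, 1], ![1, 0, 1, 1, 1], ![0, 1, 1, 1, 1]] i)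

lemma hasMDRR_one_of_three [Finite G] (φ : Multiplicative (Fin 3 → ZMod 3) →* G)
    (hφ : Function.Injective φ) : HasMDRR G 1 :=
  (good_of_refine_injective connThree (by decide +kernel) (by decide +kernel) (by decide +kernel) 2
    (by decide +kernel) (by norm_num)
    (by rw [Nat.card_eq_fintype_card]; decide +kernel) φ hφ).hasMDRR le_rfl

lemma hasMDRR_one_of_two [Finite G] (φ : Multiplicative (Fin 5 → ZMod 2) →* G)
    (hφ : Function.Injective φ) : HasMDRR G 1 :=
  (good_of_refine_injective connTwo (by decide +kernel) (by decide +kernel) (by decide +kernel) 3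
    (by decide +kernel) (by norm_num)
    (by rw [Nat.card_eq_fintype_card]; decide +kernel) φ hφ).hasMDRR le_rfl

lemma linked_cayley {S : Set G} {H : Subgroup G} (hS : H ≤ Subgroup.closure S) :
    Linked (fun _ _ : Fin 1 => S) H := by
  intro i j x hx
  obtain rfl := Subsingleton.elim i j
  have key : ∀ l ∈ Subgroup.closure S, ∀ y,
      Relation.EqvGen (Arc (fun _ _ : Fin 1 => S)) (i, y) (i, y * l) := by
    intro l hl
    induction hl using Subgroup.closure_induction with
    | mem l hl => exact fun y => .rel _ _ (by simpa [Arc] using hl)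
    | one => exact fun y => by simpa using .refl _
    | mul k l _ _ ihk ihl =>
      exact fun y => (ihk y).trans _ _ _ (by simpa [mul_assoc] using ihl (y * k))
    | inv k _ ih => exact fun y => .symm _ _ (by simpa using ih (y * k⁻¹))
  simpa using key x (hS hx) 1

lemma orderOf_dvd_card_closure_left [Finite G] (a b : G) :
    orderOf a ∣ Nat.card (Subgroup.closure {a, b}) :=
  Subgroup.orderOf_dvd_natCard _ (Subgroup.subset_closure (by simp))

lemma orderOf_dvd_card_closure_right [Finite G] (a b : G) :
    orderOf b ∣ Nat.card (Subgroup.closure {a, b}) :=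
  Subgroup.orderOf_dvd_natCard _ (Subgroup.subset_closure (by simp))

lemma orderOf_le_six [Finite G] (hno : ¬ HasMDRR G 1) (a : G) : orderOf a ≤ 6 := by
  by_contra! h
  exact hno <| (good_of_seven_le_orderOf h).hasMDRR le_rfl

lemma card_closure_le_six [Finite G] (hno : ¬ HasMDRR G 1) {a b : G} (ha : a * a ≠ 1)
    (hb : orderOf b = 2) :
    Nat.card (Subgroup.closure {a, b}) ≤ 6 ∧ Subgroup.closure {a, b} ≠ ⊤ := by
  have hb1 : b ≠ 1 := by rintro rfl; simp at hb
  have hb2 : b * b = 1 := by rw [← sq, ← hb, pow_orderOf_eq_one]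
  constructor
  · by_contra! h
    exact hno <| (good_closure_pair ha hb1 hb2 h).hasMDRR le_rfl
  · intro htop
    have h := rep_pair ha hb1 hb2
    rw [htop] at h
    exact hno (h.hasMDRR le_rfl)

lemma mul_self_eq_one_iff [Finite G] {a : G} : a * a = 1 ↔ orderOf a = 1 ∨ orderOf a = 2 := by
  rw [← sq, ← orderOf_dvd_iff_pow_eq_one, Nat.dvd_prime Nat.prime_two]

lemma eq_one_or_eq_pow_of_mem_zpowers {a y : G} {n : ℕ} (hn : orderOf a = 2 * n)
    (hy : y ∈ Subgroup.zpowers a) (hy2 : y * y = 1) : y = 1 ∨ y = a ^ n := by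
  obtain ⟨k, rfl⟩ := Subgroup.mem_zpowers_iff.1 hy
  have h1 : a ^ (2 * (n : ℤ)) = 1 := by
    have := pow_orderOf_eq_one a
    rw [hn] at this
    exact_mod_cast this
  rw [← zpow_add, ← orderOf_dvd_iff_zpow_eq_one, hn] at hy2
  obtain ⟨t, ht⟩ := hy2
  have hk : k = n * t := by
    push_cast at ht
    linarith
  obtain ⟨s, rfl | rfl⟩ := t.even_or_odd'
  · left
    rw [hk, show (n : ℤ) * (2 * s) = 2 * n * s by ring, zpow_mul, h1, one_zpow]
  · right
    rw [hk, show (n : ℤ) * (2 * s + 1) = 2 * n * s + n by ring, zpow_add, zpow_mul, h1, one_zpow,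
      one_mul, zpow_natCast]

lemma card_sup_zpowers [Finite G] (hno : ¬ HasMDRR G 1) {a b : G} (ha : 5 ≤ orderOf a)
    (hb : b ∉ Subgroup.zpowers a) :
    Nat.card (Subgroup.zpowers a ⊔ Subgroup.zpowers b : Subgroup G) = 2 * orderOf a := by
  have ha1 : a ≠ 1 := by rintro rfl; simp at ha
  have hS := (rep_singleton_zpowers ha1).compl
  have hcard : Nat.card (Subgroup.zpowers a) = orderOf a := Nat.card_zpowers a
  have hd :
      1 * Nat.card (Subgroup.zpowers a) < 2 * (1 * Nat.card (Subgroup.zpowers a) - 1 - 1) := by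
    omega
  have hR := hS.adjoin le_rfl (hS.transit_of_dense hd) (hS.linked_of_dense hd) hb
  have h2 := two_mul_card_le_of_notMem hb
  obtain ⟨k, hk⟩ := Subgroup.card_dvd_of_le
    (le_sup_left : Subgroup.zpowers a ≤ Subgroup.zpowers a ⊔ Subgroup.zpowers b)
  by_contra hne
  have hk3 : 3 ≤ k := by
    by_contra! hlt
    rw [hcard] at hk h2
    have : k = 0 ∨ k = 1 ∨ k = 2 := by omega
    rcases this with rfl | rfl | rfl <;> omega
  have h3 := Nat.mul_le_mul_left (Nat.card (Subgroup.zpowers a)) hk3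
  exact hno (Good.hasMDRR le_rfl ⟨_, _, hR, by omega, by omega⟩)

lemma lcm_orderOf_le_six [Finite G] (hno : ¬ HasMDRR G 1) {a b : G} (ha : a * a ≠ 1)
    (hb : orderOf b = 2) : Nat.lcm (orderOf a) 2 ≤ 6 := by
  refine le_trans (Nat.le_of_dvd Nat.card_pos (Nat.lcm_dvd (orderOf_dvd_card_closure_left a b) ?_))
    (card_closure_le_six hno ha hb).1
  rw [← hb]
  exact orderOf_dvd_card_closure_right a b

lemma exists_notMem_zpowers [Finite G] (hno : ¬ HasMDRR G 1) (a : G) :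
    ∃ b, b ∉ Subgroup.zpowers a :=
  (zpowers_eq_top_or a).resolve_left fun h => hno (hasMDRR_one_of_cyclic h)

lemma orderOf_ne_five [Finite G] (hno : ¬ HasMDRR G 1) (a : G) : orderOf a ≠ 5 := by
  intro ha
  obtain ⟨b, hb⟩ := exists_notMem_zpowers hno a
  have hK := card_sup_zpowers hno ha.ge hb
  rw [ha] at hK
  obtain ⟨y, hy⟩ := exists_prime_orderOf_dvd_card' 2
    (show 2 ∣ Nat.card (Subgroup.zpowers a ⊔ Subgroup.zpowers b : Subgroup G) by rw [hK]; decide)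
  have := lcm_orderOf_le_six hno (a := a) (b := y) (by rw [Ne, mul_self_eq_one_iff]; omega)
    (by rw [Subgroup.orderOf_coe, hy])
  rw [ha] at this
  revert this
  decide

lemma mul_mem_of_card_sup [Finite G] {H : Subgroup G} {b : G}
    (h : Nat.card (H ⊔ Subgroup.zpowers b : Subgroup G) = 2 * Nat.card H) : b * b ∈ H := by
  set K := H ⊔ Subgroup.zpowers b with hKdef
  have hle : H ≤ K := le_sup_left
  have hbK : b ∈ K := (le_sup_right : Subgroup.zpowers b ≤ _) (Subgroup.mem_zpowers b)
  have hidx : (H.subgroupOf K).index = 2 := by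
    have h1 := (H.subgroupOf K).card_mul_index
    rw [Nat.card_congr (Subgroup.subgroupOfEquivOfLe hle).toEquiv, h, mul_comm] at h1
    exact Nat.eq_of_mul_eq_mul_right Nat.card_pos h1
  exact Subgroup.mul_self_mem_of_index_two hidx ⟨b, hbK⟩

lemma mul_self_eq_pow_three [Finite G] (hno : ¬ HasMDRR G 1) {a b : G} (ha : orderOf a = 6)
    (hb : b ∉ Subgroup.zpowers a) : b * b = a ^ 3 := by
  have haa : a * a ≠ 1 := by rw [Ne, mul_self_eq_one_iff]; omega
  have hinv : ∀ y, y * y = 1 → y ∈ Subgroup.zpowers a := by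
    intro y hy
    by_contra hya
    have hy2 : orderOf y = 2 := by
      refine (mul_self_eq_one_iff.1 hy).resolve_left fun h => hya ?_
      rw [orderOf_eq_one_iff.1 h]
      exact one_mem _
    have h1 := (card_closure_le_six hno haa hy2).1
    have h2 : Subgroup.zpowers a ⊔ Subgroup.zpowers y ≤ Subgroup.closure {a, y} := by
      rw [sup_le_iff, Subgroup.zpowers_le, Subgroup.zpowers_le]
      exact ⟨Subgroup.subset_closure (by simp), Subgroup.subset_closure (by simp)⟩
    have h3 := Nat.le_of_dvd Nat.card_pos (Subgroup.card_dvd_of_le h2)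
    rw [card_sup_zpowers hno (by omega) hya] at h3
    omega
  have hbb : b * b ∈ Subgroup.zpowers a := mul_mem_of_card_sup <| by
    rw [card_sup_zpowers hno (by omega) hb, Nat.card_zpowers]
  have h6 := orderOf_le_six hno b
  have h5 := orderOf_ne_five hno b
  have hpos := orderOf_pos b
  have hpow := pow_orderOf_eq_one b
  have h4 : orderOf b = 4 := by
    have : orderOf b = 1 ∨ orderOf b = 2 ∨ orderOf b = 3 ∨ orderOf b = 4 ∨ orderOf b = 6 := by
      omega
    rcases this with h | h | h | h | h
    · exact absurd (hinv b (mul_self_eq_one_iff.2 (.inl h))) hb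
    · exact absurd (hinv b (mul_self_eq_one_iff.2 (.inr h))) hb
    · rw [h, pow_succ, pow_two] at hpow
      refine absurd ?_ hb
      rw [eq_inv_of_mul_eq_one_right hpow]
      exact inv_mem hbb
    · exact h
    · have h3 := hinv (b ^ 3) (by rw [← pow_add]; rwa [h] at hpow)
      rw [pow_succ, pow_two, Subgroup.mul_mem_cancel_left _ hbb] at h3
      exact absurd h3 hb
  refine (eq_one_or_eq_pow_of_mem_zpowers (n := 3) ha hbb ?_).resolve_left ?_
  · rw [h4] at hpow
    simpa [pow_succ, mul_assoc] using hpow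
  · rw [mul_self_eq_one_iff]
    omega

lemma orderOf_ne_six [Finite G] (hno : ¬ HasMDRR G 1) (a : G) : orderOf a ≠ 6 := by
  intro ha
  obtain ⟨b, hb⟩ := exists_notMem_zpowers hno a
  have hK := card_sup_zpowers hno (by omega) hb
  have hb3 := mul_self_eq_pow_three hno ha hb
  have haz := Subgroup.mem_zpowers a
  have hab3 := mul_self_eq_pow_three hno ha (b := a * b)
    (by rwa [Subgroup.mul_mem_cancel_left _ haz])
  have hbab : b * a * b = a * a := by
    rw [mul_assoc, pow_succ', pow_two] at hab3
    simpa [mul_assoc] using hab3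
  have hb1 : b ≠ 1 := fun h => hb (h ▸ one_mem _)
  have hne : ∀ k : ℕ, b ≠ a ^ k := fun k h => hb (h ▸ pow_mem haz k)
  have hpow : ∀ k : ℕ, 0 < k → k < 6 → a ^ k ≠ 1 := fun k h0 hk h => by
    have := Nat.le_of_dvd h0 (orderOf_dvd_of_pow_eq_one h)
    omega
  have ha1 : a ≠ 1 := by simpa using hpow 1
  have ha2 : a * a ≠ 1 := by simpa [pow_two] using hpow 2
  have hba : b ≠ a := by simpa using hne 1
  have hb2 : b * b ≠ 1 := hb3 ▸ hpow 3 (by omega) (by omega)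
  have hR := rep_triple (a := a) (b := b) ha1 hb1 hba.symm
    (fun h => hb (by rw [eq_inv_of_mul_eq_one_right h]; exact inv_mem haz)) ?_ ?_ ?_ ?_
  · have hle : Subgroup.zpowers a ⊔ Subgroup.zpowers b ≤ Subgroup.closure {a, b, a * b} := by
      rw [sup_le_iff, Subgroup.zpowers_le, Subgroup.zpowers_le]
      exact ⟨Subgroup.subset_closure (by simp), Subgroup.subset_closure (by simp)⟩
    have h3 := Nat.le_of_dvd Nat.card_pos (Subgroup.card_dvd_of_le hle)
    rw [hK] at h3
    exact hno (Good.hasMDRR le_rfl ⟨_, _, hR, by omega, by omega⟩)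
  all_goals
    simp only [Set.mem_insert_iff, Set.mem_singleton_iff, inv_mul_eq_iff_eq_mul, not_or]
  · refine ⟨?_, ?_, ?_⟩
    · simpa [pow_two] using hne 2
    · simpa using ha1
    · rw [← mul_assoc]
      simpa using ha2
  · refine ⟨?_, ?_, ?_⟩
    · simpa using hb1
    · rw [hb3, pow_succ]
      simpa [pow_two] using ha2
    · rw [← mul_assoc, hbab]
      simpa using ha1
  · refine ⟨?_, ?_, ?_⟩
    · intro h
      rw [mul_assoc, left_eq_mul] at h
      exact hb (by rw [eq_inv_of_mul_eq_one_left h]; exact inv_mem haz)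
    · rw [mul_assoc, left_eq_mul]
      exact hb2
    · rw [hab3]
      intro h
      apply hpow 2 (by omega) (by omega)
      simpa [pow_succ] using h
  · refine ⟨?_, ?_, ?_⟩
    · intro h
      have : a ^ 4 = a * a := by
        rw [← hbab, ← h, mul_assoc, hb3]
        rw [← pow_succ']
      apply hpow 2 (by omega) (by omega)
      simpa [pow_succ, mul_assoc] using this
    · simpa using hba.symm
    · rw [← mul_assoc, hbab]
      simpa using hba

lemma mul_self_of_three_two [Finite G] (hno : ¬ HasMDRR G 1) {a b : G} (ha : orderOf a = 3)
    (hb : b ∉ Subgroup.zpowers a) (hle : Nat.card (Subgroup.closure {a, b}) = 6) :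
    b * b = 1 := by
  have hcl : Subgroup.zpowers a ⊔ Subgroup.zpowers b ≤ Subgroup.closure {a, b} := by
    rw [sup_le_iff, Subgroup.zpowers_le, Subgroup.zpowers_le]
    exact ⟨Subgroup.subset_closure (by simp), Subgroup.subset_closure (by simp)⟩
  have h1 := two_mul_card_le_of_notMem hb
  have h2 := Nat.le_of_dvd Nat.card_pos (Subgroup.card_dvd_of_le hcl)
  have hcard : Nat.card (Subgroup.zpowers a) = 3 := by rw [Nat.card_zpowers, ha]
  have hbb := mul_mem_of_card_sup (H := Subgroup.zpowers a) (b := b) (by omega)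
  have h6 := orderOf_dvd_card_closure_right a b
  rw [hle] at h6
  have h6' := Nat.le_of_dvd (by decide) h6
  have hn6 := orderOf_ne_six hno b
  have hpow := pow_orderOf_eq_one b
  rw [mul_self_eq_one_iff]
  by_contra! hne
  have h3 : orderOf b = 3 := by
    revert h6 hn6 hne h6'
    generalize orderOf b = n
    intro h6 hn6 hne h6'
    interval_cases n <;> simp_all
  rw [h3, pow_succ, pow_two] at hpow
  refine hb ?_
  rw [eq_inv_of_mul_eq_one_right hpow]
  exact inv_mem hbb

lemma mem_closure_dihedral {a b x : G} (ha : a ^ 3 = 1) (hb : b * b = 1)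
    (hba : b * a = a * a * b) (hx : x ∈ Subgroup.closure {a, b}) :
    x = 1 ∨ x = a ∨ x = a * a ∨ x = b ∨ x = a * b ∨ x = a * a * b := by
  have ha3 : a * (a * a) = 1 := by rw [← ha, pow_succ', pow_two]
  have hai : a⁻¹ = a * a := inv_eq_of_mul_eq_one_right ha3
  have hbi : b⁻¹ = b := inv_eq_of_mul_eq_one_right hb
  have ha4 : ∀ y, a * (a * (a * y)) = y := fun y => by
    rw [← mul_assoc, ← mul_assoc, mul_assoc a, ha3, one_mul]
  have hba' : ∀ y, b * (a * y) = a * (a * (b * y)) := fun y => by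
    rw [← mul_assoc, hba]; simp only [mul_assoc]
  rw [mul_assoc] at hba
  induction hx using Subgroup.closure_induction_left with
  | one => simp
  | mul_left x hx y hy ih =>
    rcases hx with rfl | rfl <;> rcases ih with rfl | rfl | rfl | rfl | rfl | rfl <;>
      simp [mul_assoc, ha3, ha4, hb, hba, hba']
  | inv_mul_cancel x hx y hy ih =>
    rcases hx with rfl | rfl <;> rcases ih with rfl | rfl | rfl | rfl | rfl | rfl <;>
      simp [mul_assoc, ha3, ha4, hb, hba, hba', hai, hbi]

lemma orderOf_ne_two_of_three [Finite G] (hno : ¬ HasMDRR G 1) {a b : G} (ha : orderOf a = 3) :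
    orderOf b ≠ 2 := by
  intro hb
  have haa : a * a ≠ 1 := by rw [Ne, mul_self_eq_one_iff]; omega
  have ha1 : a ≠ 1 := by rintro rfl; simp at haa
  have hb1 : b ≠ 1 := by rintro rfl; simp at hb
  have hbb : b * b = 1 := mul_self_eq_one_iff.2 (.inr hb)
  obtain ⟨h6, htop⟩ := card_closure_le_six hno haa hb
  have hcard : Nat.card (Subgroup.closure {a, b}) = 6 := by
    have h1 := orderOf_dvd_card_closure_left a b
    have h2 := orderOf_dvd_card_closure_right a b
    have hpos : 0 < Nat.card (Subgroup.closure {a, b}) := Nat.card_pos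
    rw [ha] at h1
    rw [hb] at h2
    omega
  have haH : a ∈ Subgroup.closure {a, b} := Subgroup.subset_closure (by simp)
  have hbH : b ∈ Subgroup.closure {a, b} := Subgroup.subset_closure (by simp)
  have hba : b ∉ Subgroup.zpowers a := by
    intro h
    have := orderOf_dvd_of_mem_zpowers h
    rw [ha, hb] at this
    revert this
    decide
  have ha3 : a ^ 3 = 1 := by rw [← ha, pow_orderOf_eq_one]
  have ha3' : a * (a * a) = 1 := by rw [← ha3, pow_succ', pow_two]
  have hai : a⁻¹ = a * a := inv_eq_of_mul_eq_one_right ha3'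
  have hbi : b⁻¹ = b := inv_eq_of_mul_eq_one_right hbb
  have hab := mul_self_of_three_two hno (b := a * b) ha
    (by rwa [Subgroup.mul_mem_cancel_left _ (Subgroup.mem_zpowers a)]) (by
      rw [← hcard]
      suffices Subgroup.closure {a, a * b} = Subgroup.closure {a, b} by rw [this]
      have h1 : a ∈ Subgroup.closure {a, a * b} := Subgroup.subset_closure (by simp)
      have h2 : a * b ∈ Subgroup.closure {a, a * b} := Subgroup.subset_closure (by simp)
      apply le_antisymm <;> rw [Subgroup.closure_le] <;> rintro x (rfl | rfl)
      · exact haH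
      · exact mul_mem haH hbH
      · exact h1
      · exact (Subgroup.mul_mem_cancel_left _ h1).1 h2)
  have hrel : b * a = a * a * b := by
    rw [mul_assoc] at hab
    rw [← hai, ← eq_inv_of_mul_eq_one_right hab, mul_assoc, mul_assoc, hbb, mul_one]
  have hne : ∀ k : ℕ, b ≠ a ^ k := fun k h => hba (h ▸ pow_mem (Subgroup.mem_zpowers a) k)
  have hR := (rep_pair haa hb1 hbb).compl
  have hmem : ∀ x, x ∈ compl (fun _ _ : Fin 1 => {a, b}) (Subgroup.closure {a, b}) 0 0 ↔
      x = a * a ∨ x = a * b ∨ x = a * a * b := by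
    intro x
    simp only [compl, Set.mem_ofPred_eq, Set.mem_insert_iff, Set.mem_singleton_iff, true_and]
    constructor
    · rintro ⟨hx, h1, h2⟩
      have := mem_closure_dihedral ha3 hbb hrel hx
      tauto
    · have hn2 : ∀ y, y ∈ Subgroup.zpowers a → y * b ∉ Subgroup.zpowers a := fun y hy h =>
        hba ((Subgroup.mul_mem_cancel_left _ hy).1 h)
      have haz := Subgroup.mem_zpowers a
      rintro (rfl | rfl | rfl)
      · refine ⟨mul_mem haH haH, ?_, haa⟩
        rintro (h | h)
        · exact ha1 (by simpa using h)
        · exact hne 2 (by rw [← h, pow_two])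
      · refine ⟨mul_mem haH hbH, ?_, fun h => hn2 a haz (h ▸ one_mem _)⟩
        rintro (h | h)
        · exact hb1 (by simpa using h)
        · exact ha1 (by simpa using h)
      · refine ⟨mul_mem (mul_mem haH haH) hbH, ?_,
          fun h => hn2 _ (mul_mem haz haz) (h ▸ one_mem _)⟩
        rintro (h | h)
        · exact hn2 _ (mul_mem haz haz) (h.symm ▸ haz)
        · exact haa (by simpa using h)
  obtain ⟨c, hc⟩ : ∃ c, c ∉ Subgroup.closure {a, b} := by
    by_contra! h
    exact htop (eq_top_iff.2 fun x _ => h x)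
  refine hno (Good.hasMDRR le_rfl (hR.good_adjoin le_rfl ?_ ?_ (by omega) (by omega) hc))
  · intro i j t ht
    obtain rfl := Subsingleton.elim 0 i
    obtain rfl := Subsingleton.elim 0 j
    refine ⟨0, ?_⟩
    rw [hmem] at ht
    simp only [hmem]
    rcases ht with rfl | rfl | rfl
    · refine ⟨a * b, by simp, .inr (.inr ?_)⟩
      rw [mul_inv_rev, mul_assoc, inv_mul_cancel_left, hbi, hrel]
    · refine ⟨a * a, by simp, .inr (.inr ?_)⟩
      rw [mul_inv_rev, mul_assoc, inv_mul_cancel_left, hai]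
    · refine ⟨a * b, by simp, .inl ?_⟩
      rw [mul_inv_rev, mul_assoc, mul_assoc, inv_mul_cancel_left, hbi, ← mul_assoc, hrel, mul_assoc,
        hbb, mul_one]
  · have heq : compl (fun _ _ : Fin 1 => {a, b}) (Subgroup.closure {a, b}) =
        fun _ _ => compl (fun _ _ : Fin 1 => {a, b}) (Subgroup.closure {a, b}) 0 0 := by
      funext i j
      rw [Subsingleton.elim i 0, Subsingleton.elim j 0]
    rw [heq]
    refine linked_cayley ?_
    rw [Subgroup.closure_le]
    have h1 : a * a ∈ Subgroup.closure
        (compl (fun _ _ : Fin 1 => {a, b}) (Subgroup.closure {a, b}) 0 0) :=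
      Subgroup.subset_closure ((hmem _).2 (by simp))
    have h2 : a * a * b ∈ Subgroup.closure
        (compl (fun _ _ : Fin 1 => {a, b}) (Subgroup.closure {a, b}) 0 0) :=
      Subgroup.subset_closure ((hmem _).2 (by simp))
    rintro x (rfl | rfl)
    · have h3 := mul_mem h1 h1
      rwa [mul_assoc, ha3', mul_one] at h3
    · exact (Subgroup.mul_mem_cancel_left _ h1).1 h2

/-- The isomorphism with the quaternion group of order 8, given generators `x`, `y`. -/
noncomputable def quaternionEquiv {x y : G} (hx : orderOf x = 4) (hyy : y * y = x ^ 2)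
    (hxy : y * x * y = x) (hy : y ∉ Subgroup.zpowers x)
    (hcov : ∀ w, w ∈ Subgroup.zpowers x ∨ y⁻¹ * w ∈ Subgroup.zpowers x) :
    QuaternionGroup 2 ≃* G := by
  let X : ZMod (2 * 2) → G := fun i => x ^ i.val
  have hX : ∀ i j, X (i + j) = X i * X j := fun i j => by
    simp only [X, ZMod.val_add, ← pow_add]
    conv_rhs => rw [← pow_mod_orderOf, hx]
  have hXmem : ∀ i, X i ∈ Subgroup.zpowers x := fun i => pow_mem (Subgroup.mem_zpowers x) _
  have hX0 : X 0 = 1 := by simp [X]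
  have hX2 : X 2 = x ^ 2 := rfl
  have hXinj : ∀ i j, X i = X j → i = j := fun i j h => by
    have := (pow_inj_mod (x := x)).1 h
    rw [hx] at this
    exact ZMod.val_injective _ (by
      rwa [Nat.mod_eq_of_lt i.val_lt, Nat.mod_eq_of_lt j.val_lt] at this)
  have hXsurj : ∀ w ∈ Subgroup.zpowers x, ∃ i, X i = w := by
    intro w hw
    have hfin : IsOfFinOrder x := orderOf_pos_iff.1 (by omega)
    obtain ⟨k, rfl⟩ := hfin.mem_powers_iff_mem_zpowers.2 hw
    refine ⟨(k : ZMod (2 * 2)), ?_⟩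
    simp only [X, ZMod.val_natCast]
    rw [← pow_mod_orderOf x k, hx]
  have hXneg : ∀ i, X (-i) = (X i)⁻¹ := fun i =>
    eq_inv_of_mul_eq_one_left (by rw [← hX, neg_add_cancel, hX0])
  have hconj : ∀ i, X i * y = y * X (-i) := by
    intro i
    have h1 : y⁻¹ * x * y = x⁻¹ := by
      rw [mul_assoc, ← eq_inv_mul_iff_mul_eq] at hxy
      rw [mul_assoc, hxy, ← mul_assoc, ← mul_inv_rev, hyy, pow_two, mul_inv_rev, mul_assoc,
        inv_mul_cancel, mul_one]
    have h3 : y⁻¹ * X i * y = (X i)⁻¹ := by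
      have := conj_pow (a := y⁻¹) (b := x) (i := i.val)
      rw [inv_inv, h1, inv_pow] at this
      exact this.symm
    rw [hXneg, ← h3]
    group
  refine MulEquiv.ofBijective (MonoidHom.mk' (fun q => match q with
    | .a i => X i
    | .xa i => y * X i) ?_) ⟨?_, ?_⟩
  · rintro (i | i) (j | j)
    · rw [QuaternionGroup.a_mul_a]
      exact hX i j
    · rw [QuaternionGroup.a_mul_xa]
      change y * X (j - i) = X i * (y * X j)
      rw [← mul_assoc, hconj, mul_assoc, ← hX, sub_eq_neg_add]
    · rw [QuaternionGroup.xa_mul_a]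
      change y * X (i + j) = y * X i * X j
      rw [hX, mul_assoc]
    · rw [QuaternionGroup.xa_mul_xa]
      change X (2 + j - i) = y * X i * (y * X j)
      rw [mul_assoc, ← mul_assoc (X i), hconj, mul_assoc, ← mul_assoc, hyy, ← hX2, ← hX, ← hX]
      congr 1
      ring
  · rintro (i | i) (j | j) h
    · exact congrArg _ (hXinj i j h)
    · have h' : X i = y * X j := h
      exact absurd ((Subgroup.mul_mem_cancel_right _ (hXmem j)).1 (h' ▸ hXmem i)) hy
    · have h' : y * X i = X j := h
      exact absurd ((Subgroup.mul_mem_cancel_right _ (hXmem i)).1 (h'.symm ▸ hXmem j)) hy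
    · exact congrArg _ (hXinj i j (mul_left_cancel h))
  · intro w
    rcases hcov w with h | h
    · obtain ⟨i, hi⟩ := hXsurj w h
      exact ⟨.a i, hi⟩
    · obtain ⟨i, hi⟩ := hXsurj _ h
      exact ⟨.xa i, by change y * X i = w; rw [hi, mul_inv_cancel_left]⟩

lemma nonempty_quaternionEquiv [Finite G] (hno : ¬ HasMDRR G 1) {x : G} (hx : orderOf x = 4) :
    Nonempty (G ≃* QuaternionGroup 2) := by
  have hxx : x * x ≠ 1 := by rw [Ne, mul_self_eq_one_iff]; omega
  have hx2 : orderOf (x ^ 2) = 2 := by simp [orderOf_pow, hx]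
  have hinv : ∀ y, y * y = 1 → y ∈ Subgroup.zpowers x := by
    intro y hy
    rcases mul_self_eq_one_iff.1 hy with h | h
    · rw [orderOf_eq_one_iff.1 h]
      exact one_mem _
    · have h6 := (card_closure_le_six hno hxx h).1
      have h4 := orderOf_dvd_card_closure_left x y
      have hpos : 0 < Nat.card (Subgroup.closure {x, y}) := Nat.card_pos
      rw [hx] at h4
      have hle : Subgroup.zpowers x ≤ Subgroup.closure {x, y} := by
        rw [Subgroup.zpowers_le]
        exact Subgroup.subset_closure (by simp)
      rw [Subgroup.eq_of_le_of_card_ge hle (by rw [Nat.card_zpowers]; omega)]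
      exact Subgroup.subset_closure (by simp)
  have hsq : ∀ y, y ∉ Subgroup.zpowers x → y * y = x ^ 2 := by
    intro y hy
    have hpow := pow_orderOf_eq_one y
    have h4 : orderOf y = 4 := by
      have h1 := orderOf_le_six hno y
      have h2 := orderOf_ne_five hno y
      have h3 := orderOf_ne_six hno y
      have h5 : orderOf y ≠ 3 := fun h => orderOf_ne_two_of_three hno h hx2
      have h7 : ¬ (orderOf y = 1 ∨ orderOf y = 2) := fun h => hy (hinv y (mul_self_eq_one_iff.2 h))
      have := orderOf_pos y
      omega
    have hyy : y * y * (y * y) = 1 := by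
      rw [h4] at hpow
      simpa [pow_succ, mul_assoc] using hpow
    refine (eq_one_or_eq_pow_of_mem_zpowers (n := 2) hx (hinv _ hyy) hyy).resolve_left ?_
    rw [mul_self_eq_one_iff]
    omega
  have hxz := Subgroup.mem_zpowers x
  have hconj : ∀ y, y ∉ Subgroup.zpowers x → y * x * y = x := by
    intro y hy
    have := hsq (x * y) (by rwa [Subgroup.mul_mem_cancel_left _ hxz])
    rw [pow_two, mul_assoc, mul_left_cancel_iff, ← mul_assoc] at this
    exact this
  obtain ⟨y, hy⟩ := exists_notMem_zpowers hno x
  refine ⟨(quaternionEquiv hx (hsq y hy) (hconj y hy) hy fun w => ?_).symm⟩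
  by_contra! hw
  have hy1 := eq_mul_inv_of_mul_eq (hconj y hy)
  have hv1 := eq_mul_inv_of_mul_eq (hconj _ hw.2)
  have hv2 := hsq _ hw.2
  have hw1 := hconj w hw.1
  have hw2 := hsq w hw.1
  obtain ⟨v, rfl⟩ : ∃ v, w = y * v := ⟨y⁻¹ * w, by simp⟩
  rw [inv_mul_cancel_left] at hv1 hv2
  have hcomm : y * v = v * y := by
    rw [mul_assoc y v x, hv1, ← mul_assoc y, hy1] at hw1
    have : y⁻¹ * v⁻¹ * (y * v) = 1 := by
      rwa [mul_assoc x, mul_assoc x, mul_eq_left] at hw1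
    rw [← mul_inv_rev, inv_mul_eq_one] at this
    exact this.symm
  apply hxx
  rw [← pow_two, ← hw2, mul_assoc, ← mul_assoc v, ← hcomm, mul_assoc, hv2, ← mul_assoc, hsq y hy,
    ← pow_add, orderOf_dvd_iff_pow_eq_one.1 (hx ▸ dvd_rfl)]

lemma exists_addEquiv_pi {K A : Type} [Field K] [AddCommGroup A] [Module K A] [Finite A] :
    ∃ n, Nonempty (A ≃+ (Fin n → K)) := by
  have : Module.Finite K A := Module.Finite.of_finite
  exact ⟨_, ⟨(Module.finBasis K A).equivFun.toAddEquiv⟩⟩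

lemma exists_addEquiv_of_exponent {A : Type} [AddCommGroup A] [Finite A] {p : ℕ}
    [Fact p.Prime] (hp : ∀ x : A, p • x = 0) : ∃ n, Nonempty (A ≃+ (Fin n → ZMod p)) :=
  @exists_addEquiv_pi (ZMod p) A _ _ (AddCommGroup.zmodModule hp) _

lemma exists_mulEquiv_of_exponent [Finite G] {p : ℕ} [Fact p.Prime] (hp : ∀ x : G, x ^ p = 1)
    (hcomm : ∀ x y : G, x * y = y * x) :
    ∃ n, Nonempty (G ≃* Multiplicative (Fin n → ZMod p)) := by
  let : CommGroup G := { mul_comm := hcomm }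
  obtain ⟨n, ⟨e⟩⟩ := exists_addEquiv_of_exponent (A := Additive G) (p := p) fun x => hp x.toMul
  exact ⟨n, ⟨AddEquiv.toMultiplicativeRight e⟩⟩

lemma exists_injective_hom_of_le {k n p : ℕ} (hk : 0 < k) (hkn : k ≤ n) :
    ∃ φ : Multiplicative (Fin k → ZMod p) →* Multiplicative (Fin n → ZMod p),
      Function.Injective φ := by
  have : Nonempty (Fin k) := ⟨⟨0, hk⟩⟩
  have hsurj : Function.Surjective (Function.invFun (Fin.castLE hkn)) :=
    Function.invFun_surjective (Fin.castLE_injective hkn)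
  exact ⟨(LinearMap.funLeft (ZMod p) (ZMod p) _).toAddMonoidHom.toMultiplicative,
    LinearMap.funLeft_injective_of_surjective (ZMod p) (ZMod p) _ hsurj⟩

lemma hasMDRR_one_of_isCyclic [Finite G] [IsCyclic G] : HasMDRR G 1 := by
  obtain ⟨g, hg⟩ := IsCyclic.exists_generator (α := G)
  exact hasMDRR_one_of_cyclic (a := g) (eq_top_iff.2 fun x _ => hg x)

lemma exists_rank_of_exponent [Finite G] (hno : ¬ HasMDRR G 1) {p k : ℕ} [Fact p.Prime]
    (hp : ∀ x : G, x ^ p = 1) (hcomm : ∀ x y : G, x * y = y * x) (hk : 0 < k)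
    (hemb : ∀ φ : Multiplicative (Fin k → ZMod p) →* G, Function.Injective φ → HasMDRR G 1) :
    ∃ n, 2 ≤ n ∧ n < k ∧ Nonempty (G ≃* Multiplicative (Fin n → ZMod p)) := by
  obtain ⟨n, ⟨e⟩⟩ := exists_mulEquiv_of_exponent hp hcomm
  refine ⟨n, ?_, ?_, ⟨e⟩⟩
  · by_contra! hn
    have hcard : Nat.card G = p ^ n := by
      rw [Nat.card_congr e.toEquiv, Nat.card_congr Multiplicative.toAdd]
      simp
    have : IsCyclic G := by
      interval_cases n
      · have : Subsingleton G := (Nat.card_eq_one_iff_unique.1 (by simpa using hcard)).1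
        infer_instance
      · exact isCyclic_of_prime_card (p := p) (by simpa using hcard)
    exact hno hasMDRR_one_of_isCyclic
  · by_contra! hn
    obtain ⟨φ, hφ⟩ := exists_injective_hom_of_le (p := p) hk hn
    exact hno (hemb (e.symm.toMonoidHom.comp φ) (e.symm.injective.comp hφ))

lemma commute_of_exponent_three [Finite G] (hno : ¬ HasMDRR G 1) (h3 : ∀ x : G, x ^ 3 = 1)
    (a b : G) : a * b = b * a := by
  by_contra hab
  have hc : ∀ x : G, x * x = x⁻¹ := fun x =>
    eq_inv_of_mul_eq_one_left (by rw [← pow_two, ← pow_succ, h3])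
  have hsq : ∀ x y : G, x * x = y * y → x = y := fun x y h => by
    rwa [hc, hc, inv_inj] at h
  have ha : a ≠ 1 := by rintro rfl; simp at hab
  have hb : b ≠ 1 := by rintro rfl; simp at hab
  have hne : a ≠ b := by rintro rfl; simp at hab
  have hne' : a ≠ b⁻¹ := by rintro rfl; simp at hab
  have haa : a * a ≠ 1 := by simpa [hc] using ha
  have hbb : b * b ≠ 1 := by simpa [hc] using hb
  have hR := rep_triple ha hb hne (by rwa [Ne, mul_eq_one_iff_eq_inv]) ?_ ?_ ?_ ?_
  · have haS : a ∈ Subgroup.closure {a, b, a * b} := Subgroup.subset_closure (by simp)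
    have hbS : b ∈ Subgroup.closure {a, b, a * b} := Subgroup.subset_closure (by simp)
    have hle : Subgroup.zpowers a ⊔ Subgroup.zpowers b ≤ Subgroup.closure {a, b, a * b} := by
      rw [sup_le_iff, Subgroup.zpowers_le, Subgroup.zpowers_le]
      exact ⟨haS, hbS⟩
    have hba : b ∉ Subgroup.zpowers a := by
      rintro ⟨k, rfl⟩
      exact hab (Commute.self_zpow a k)
    have h1 := two_mul_card_le_of_notMem hba
    have h2 := Nat.le_of_dvd Nat.card_pos (Subgroup.card_dvd_of_le hle)
    rw [Nat.card_zpowers, orderOf_eq_prime (h3 a) ha] at h1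
    have hP : IsPGroup 3 (Subgroup.closure {a, b, a * b}) := fun x =>
      ⟨1, by ext; simpa using h3 x⟩
    obtain ⟨n, hn⟩ := IsPGroup.iff_card.1 hP
    have hn2 : 2 ≤ n := by
      by_contra! hlt
      interval_cases n <;> omega
    have h9 : 3 ^ 2 ≤ 3 ^ n := Nat.pow_le_pow_right (by decide) hn2
    exact hno (Good.hasMDRR le_rfl ⟨_, _, hR, by omega, by omega⟩)
  all_goals
    simp only [Set.mem_insert_iff, Set.mem_singleton_iff, inv_mul_eq_iff_eq_mul, not_or]
  · refine ⟨fun h => hab (by rw [h, mul_assoc]), by simpa using ha, ?_⟩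
    rw [← mul_assoc]
    simpa using haa
  · refine ⟨by simpa using hb, fun h => hne' (by rw [h, hc]), fun h => hb ?_⟩
    have : a * b * (a * b) = a * a := by
      rw [mul_assoc, ← h]
    simpa using hsq _ _ this
  · refine ⟨fun h => ?_, ?_, fun h => ?_⟩
    · rw [mul_assoc, left_eq_mul, mul_eq_one_iff_eq_inv] at h
      exact hne' (by rw [h, inv_inv])
    · rw [mul_assoc, left_eq_mul]
      exact hbb
    · rw [mul_assoc, left_eq_mul] at h
      have := eq_inv_of_mul_eq_one_right h
      rw [← hc, mul_left_inj] at this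
      exact hne this
  · refine ⟨hab, by simpa using hne, ?_⟩
    simpa using hb

lemma exception_of_not_hasMDRR_one [Finite G] (hno : ¬ HasMDRR G 1) :
    Nonempty (G ≃* QuaternionGroup 2) ∨
      Nonempty (G ≃* Multiplicative (Fin 2 → ZMod 2)) ∨
      Nonempty (G ≃* Multiplicative (Fin 3 → ZMod 2)) ∨
      Nonempty (G ≃* Multiplicative (Fin 4 → ZMod 2)) ∨
      Nonempty (G ≃* Multiplicative (Fin 2 → ZMod 3)) := by
  have hord : ∀ x : G, orderOf x = 1 ∨ orderOf x = 2 ∨ orderOf x = 3 ∨ orderOf x = 4 := by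
    intro x
    have h1 := orderOf_le_six hno x
    have h2 := orderOf_ne_five hno x
    have h3 := orderOf_ne_six hno x
    have := orderOf_pos x
    omega
  by_cases h4 : ∃ x : G, orderOf x = 4
  · obtain ⟨x, hx⟩ := h4
    exact .inl (nonempty_quaternionEquiv hno hx)
  push Not at h4
  by_cases h3 : ∃ a : G, orderOf a = 3
  · obtain ⟨a, ha⟩ := h3
    have hexp : ∀ x : G, x ^ 3 = 1 := fun x => by
      rw [← orderOf_dvd_iff_pow_eq_one]
      have := orderOf_ne_two_of_three hno (b := x) ha
      rcases hord x with h | h | h | h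
      · simp [h]
      · exact absurd h this
      · simp [h]
      · exact absurd h (h4 x)
    obtain ⟨n, hn, hn', e⟩ := exists_rank_of_exponent hno hexp (commute_of_exponent_three hno hexp)
      (k := 3) (by decide) hasMDRR_one_of_three
    obtain rfl : n = 2 := by omega
    tauto
  · push Not at h3
    have hexp : ∀ x : G, x ^ 2 = 1 := fun x => by
      rw [pow_two, mul_self_eq_one_iff]
      have := hord x
      have := h3 x
      have := h4 x
      tauto
    have hcomm : ∀ x y : G, x * y = y * x := fun x y => by
      have hinv : ∀ z : G, z⁻¹ = z := fun z =>
        inv_eq_of_mul_eq_one_left (by rw [← pow_two, hexp])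
      rw [← hinv (x * y), mul_inv_rev, hinv, hinv]
    obtain ⟨n, hn, hn', e⟩ := exists_rank_of_exponent hno hexp hcomm
      (k := 5) (by decide) hasMDRR_one_of_two
    interval_cases n <;> tauto

end MCayley

namespace MCayley

variable {G : Type} [Group G] {V : Type}

/-- `A` is a `d`-regular digraph whose automorphism group is `ρ G`, acting semiregularly. -/
structure RegularRep (A : V → V → Prop) (ρ : G →* Equiv.Perm V) (d : ℕ) : Prop where
  loopless : ∀ v, ¬ A v v
  outdeg : ∀ v, {u | A v u}.ncard = d
  indeg : ∀ v, {u | A u v}.ncard = d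
  full : ∀ σ, IsDigraphAut A σ → ∃ g, ρ g = σ
  free : ∀ g v, ρ g v = v → g = 1

lemma RegularRep.compl [Finite V] {A : V → V → Prop} {ρ : G →* Equiv.Perm V} {d : ℕ}
    (h : RegularRep A ρ d) :
    RegularRep (fun u v => ¬ A u v ∧ u ≠ v) ρ (Nat.card V - (d + 1)) where
  loopless := by simp
  outdeg v := by
    have : {u | ¬ A v u ∧ v ≠ u} = (insert v {u | A v u})ᶜ := by
      ext u; simp [eq_comm, and_comm]
    rw [this, Set.ncard_compl, Set.ncard_insert_of_notMem (by simpa using h.loopless v), h.outdeg]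
  indeg v := by
    have : {u | ¬ A u v ∧ u ≠ v} = (insert v {u | A u v})ᶜ := by
      ext u; simp [and_comm]
    rw [this, Set.ncard_compl, Set.ncard_insert_of_notMem (by simpa using h.loopless v), h.indeg]
  full σ hσ := by
    refine h.full σ fun u v => ?_
    by_cases huv : u = v
    · subst huv; simp [h.loopless]
    · have := hσ u v
      simp only [ne_eq, σ.injective.eq_iff, huv, not_false_eq_true, and_true] at this
      exact not_iff_not.1 this
  free := h.free

lemma RegularRep.valency_ne_zero [Finite V] {A : V → V → Prop} {ρ : G →* Equiv.Perm V}
    (h : RegularRep A ρ 0) {a b : V} (hab : ∀ g, ρ g a ≠ b) : False := by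
  classical
  have hA : ∀ u v, ¬ A u v := fun u v huv => by
    have := (Set.ncard_eq_zero).1 (h.outdeg u)
    exact (Set.ext_iff.1 this v).1 huv
  obtain ⟨g, hg⟩ := h.full (Equiv.swap a b) fun u v => by simp [hA]
  exact hab g (by rw [hg, Equiv.swap_apply_left])

lemma RegularRep.valency_ne_one [Finite V] {A : V → V → Prop} {ρ : G →* Equiv.Perm V}
    (h : RegularRep A ρ 1) {a b : V} (hab : ∀ g, ρ g a ≠ b) : False := by
  classical
  have hout : ∀ v, ∃ w, ∀ u, A v u ↔ u = w := fun v => by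
    obtain ⟨w, hw⟩ := Set.ncard_eq_one.1 (h.outdeg v)
    exact ⟨w, fun u => Set.ext_iff.1 hw u⟩
  choose f hf using hout
  have hinj : Function.Injective f := fun u v huv => by
    obtain ⟨w, hw⟩ := Set.ncard_eq_one.1 (h.indeg (f u))
    have hw' : ∀ x, A x (f u) ↔ x = w := fun x => Set.ext_iff.1 hw x
    rw [(hw' u).1 ((hf u _).2 rfl), (hw' v).1 ((hf v _).2 huv)]
  let π : Equiv.Perm V := Equiv.ofBijective f (Finite.injective_iff_bijective.1 hinj)
  have hA : ∀ u v, A u v ↔ v = π u := hf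
  have haut : ∀ σ : Equiv.Perm V, (∀ v, σ (π v) = π (σ v)) → IsDigraphAut A σ :=
    fun σ hσ u v => by rw [hA, hA, ← hσ, σ.injective.eq_iff]
  obtain ⟨g, hg⟩ := h.full π (haut π fun _ => rfl)
  have hmem : ∀ v, (∃ k, ρ k a = v) ↔ ∃ k, ρ k a = π v := fun v => by
    rw [← hg]
    constructor
    · rintro ⟨k, rfl⟩
      exact ⟨g * k, by simp⟩
    · rintro ⟨k, hk⟩
      exact ⟨g⁻¹ * k, by simp [hk]⟩
  let σ : Equiv.Perm V := Equiv.Perm.ofSubtype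
    (π.subtypePerm (p := fun v => ∃ k, ρ k a = v) fun v => (hmem v).symm)
  have hσ : ∀ v, (∃ k, ρ k a = v) → σ v = π v := fun v hv =>
    Equiv.Perm.ofSubtype_apply_of_mem (p := fun v => ∃ k, ρ k a = v) _ hv
  have hσ' : ∀ v, (¬ ∃ k, ρ k a = v) → σ v = v := fun v hv =>
    Equiv.Perm.ofSubtype_apply_of_not_mem (p := fun v => ∃ k, ρ k a = v) _ hv
  obtain ⟨k, hk⟩ := h.full σ <| haut σ fun v => by
    by_cases hv : ∃ k, ρ k a = v
    · rw [hσ _ ((hmem v).1 hv), hσ v hv]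
    · rw [hσ' _ fun h' => hv ((hmem v).2 h'), hσ' v hv]
  have hk1 : k = 1 := h.free k b (by rw [hk]; exact hσ' b fun ⟨g, hg⟩ => hab g hg)
  have : π a = a := by rw [← hσ a ⟨1, by simp⟩, ← hk, hk1]; simp
  exact h.loopless a ((hA a a).2 this.symm)

lemma RegularRep.valency_bounds [Finite V] {A : V → V → Prop} {ρ : G →* Equiv.Perm V} {d : ℕ}
    (h : RegularRep A ρ d) {a b : V} (hab : ∀ g, ρ g a ≠ b) :
    2 ≤ d ∧ d + 3 ≤ Nat.card V := by
  have key : ∀ {B : V → V → Prop} {d : ℕ}, RegularRep B ρ d → 2 ≤ d := fun {B d} hB => by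
    by_contra hd
    obtain rfl | rfl : d = 0 ∨ d = 1 := by omega
    · exact hB.valency_ne_zero hab
    · exact hB.valency_ne_one hab
  have h1 := key h
  have h2 := key h.compl
  omega

/-- The adjacency relation with row `f`, written in base `8`. -/
def octalRow (f : Fin 5 → Bool) : ℕ :=
  (f 0).toNat + 8 * (f 1).toNat + 64 * (f 2).toNat + 512 * (f 3).toNat + 4096 * (f 4).toNat

/-- The possible values of `octalRow` in row `i` of a loopless digraph of valency `2`. -/
def octalRows (i : ℕ) : List ℕ :=
  [9, 65, 72, 513, 520, 576, 4097, 4104, 4160, 4608].filter fun a => !a.testBit (3 * i)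

lemma octalRow_spec (f : Fin 5 → Bool) (i : Fin 5) :
    (f i = false → (f 0).toNat + (f 1).toNat + (f 2).toNat + (f 3).toNat + (f 4).toNat = 2 →
      octalRow f ∈ octalRows i) ∧ (octalRow f).testBit (3 * i) = f i := by
  have key : ∀ (a b c d e : Bool) (i : Fin 5), (![a, b, c, d, e] i = false →
      a.toNat + b.toNat + c.toNat + d.toNat + e.toNat = 2 →
      octalRow ![a, b, c, d, e] ∈ octalRows i) ∧
        (octalRow ![a, b, c, d, e]).testBit (3 * i) = ![a, b, c, d, e] i := by
    decide +kernel
  have hf : ![f 0, f 1, f 2, f 3, f 4] = f := by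
    funext i; fin_cases i <;> rfl
  have := key (f 0) (f 1) (f 2) (f 3) (f 4) i
  rwa [hf] at this

/-- Permutations fixing, between them, all digraphs of valency `2` on five vertices. -/
def fivePerms : List (List ℕ) :=
  [[0, 2, 1, 4, 3], [0, 3, 4, 1, 2], [0, 4, 3, 2, 1], [1, 0, 2, 4, 3], [1, 0, 3, 2, 4],
    [1, 0, 4, 3, 2], [2, 1, 0, 4, 3], [2, 3, 0, 1, 4], [2, 4, 0, 3, 1], [3, 1, 4, 0, 2],
    [3, 2, 1, 0, 4], [3, 4, 2, 0, 1], [4, 1, 3, 2, 0], [4, 2, 1, 3, 0], [4, 3, 2, 1, 0],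
    [1, 2, 3, 4, 0], [1, 2, 4, 0, 3], [1, 3, 0, 4, 2], [1, 3, 4, 2, 0], [1, 4, 0, 2, 3],
    [1, 4, 3, 0, 2]]

lemma fivePerms_spec : ∀ t ∈ fivePerms,
    Function.Injective (fun i : Fin 5 => Fin.ofNat 5 (t.getD i 0)) ∧
      (fun i : Fin 5 => Fin.ofNat 5 (t.getD i 0)) ≠ id ∧ ∀ i : Fin 5, t.getD i 0 < 5 := by
  decide +kernel

/-- The permutation listed in `t` preserves the digraph with rows listed in `r`. -/
def octalAut (r t : List ℕ) : Bool :=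
  (List.range 5).all fun i => (List.range 5).all fun j =>
    (r.getD (t.getD i 0) 0).testBit (3 * t.getD j 0) == (r.getD i 0).testBit (3 * j)

lemma exists_octalAut : ((octalRows 0).all fun a => (octalRows 1).all fun b =>
    (octalRows 2).all fun c => (octalRows 3).all fun d => (octalRows 4).all fun e =>
      !Nat.beq (a + b + c + d + e) 9362 ||
        fivePerms.any fun t => octalAut [a, b, c, d, e] t) = true := by
  decide +kernel

lemma ncard_fin_five (P : Fin 5 → Prop) [DecidablePred P] :
    {u | P u}.ncard = (decide (P 0)).toNat + (decide (P 1)).toNat + (decide (P 2)).toNat +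
      (decide (P 3)).toNat + (decide (P 4)).toNat := by
  have : {u | P u} = ((Finset.univ.filter P : Finset (Fin 5)) : Set (Fin 5)) := by simp
  rw [this, Set.ncard_coe_finset, Finset.card_filter, Fin.sum_univ_five]
  have h : ∀ (p : Prop) [Decidable p], (decide p).toNat = if p then 1 else 0 := fun p _ => by
    by_cases hp : p <;> simp [hp]
  simp only [h]

lemma exists_aut_of_two_regular (A : Fin 5 → Fin 5 → Prop) (hl : ∀ v, ¬ A v v)
    (hout : ∀ v, {u | A v u}.ncard = 2) (hin : ∀ v, {u | A u v}.ncard = 2) :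
    ∃ σ : Equiv.Perm (Fin 5), IsDigraphAut A σ ∧ σ ≠ 1 := by
  classical
  let f : Fin 5 → Fin 5 → Bool := fun i j => decide (A i j)
  have hmem : ∀ i : Fin 5, octalRow (f i) ∈ octalRows i := fun i =>
    (octalRow_spec (f i) i).1 (by simp [f, hl]) ((ncard_fin_five _).symm.trans (hout i))
  have hbit : ∀ i j : Fin 5, (octalRow (f i)).testBit (3 * j) = f i j := fun i j =>
    (octalRow_spec (f i) j).2
  have hsum : octalRow (f 0) + octalRow (f 1) + octalRow (f 2) + octalRow (f 3) +
      octalRow (f 4) = 9362 := by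
    have h : ∀ j, (f 0 j).toNat + (f 1 j).toNat + (f 2 j).toNat + (f 3 j).toNat +
      (f 4 j).toNat = 2 := fun j => (ncard_fin_five _).symm.trans (hin j)
    have h0 := h 0
    have h1 := h 1
    have h2 := h 2
    have h3 := h 3
    have h4 := h 4
    simp only [octalRow]
    omega
  have hkey := exists_octalAut
  simp only [List.all_eq_true] at hkey
  have hkey := hkey _ (hmem 0) _ (hmem 1) _ (hmem 2) _ (hmem 3) _ (hmem 4)
  rw [hsum] at hkey
  obtain ⟨t, ht, h⟩ := List.any_eq_true.1 (by simpa using hkey)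
  obtain ⟨hinj, hid, hlt⟩ := fivePerms_spec t ht
  simp only [octalAut, List.all_eq_true, List.mem_range, beq_iff_eq] at h
  have hrow : ∀ i : Fin 5, [octalRow (f 0), octalRow (f 1), octalRow (f 2), octalRow (f 3),
      octalRow (f 4)].getD i 0 = octalRow (f i) := by
    intro i; fin_cases i <;> rfl
  refine ⟨Equiv.ofBijective _ (Finite.injective_iff_bijective.1 hinj), fun i j => ?_,
    fun e => hid ?_⟩
  · have hval : ∀ i : Fin 5, t.getD i 0 = (Fin.ofNat 5 (t.getD i 0) : Fin 5) := fun i =>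
      (Nat.mod_eq_of_lt (hlt i)).symm
    have := h i i.2 j j.2
    rw [hval i, hval j, hrow, hrow, hbit, hbit] at this
    simpa [f] using this
  · funext i
    exact congrArg (fun σ : Equiv.Perm (Fin 5) => σ i) e

lemma exists_aut_of_card_five {A : V → V → Prop} (hV : Nat.card V = 5) (hl : ∀ v, ¬ A v v)
    (hout : ∀ v, {u | A v u}.ncard = 2) (hin : ∀ v, {u | A u v}.ncard = 2) :
    ∃ σ : Equiv.Perm V, IsDigraphAut A σ ∧ σ ≠ 1 := by
  have : Finite V := Nat.finite_of_card_ne_zero (by omega)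
  let e : V ≃ Fin 5 := Finite.equivFinOfCardEq hV
  have hcard : ∀ P : V → Prop, {i | P (e.symm i)}.ncard = {u | P u}.ncard := fun P => by
    have : {i | P (e.symm i)} = e '' {u | P u} := by ext i; simp [e.image_eq_preimage_symm]
    rw [this, Set.ncard_image_of_injective _ e.injective]
  obtain ⟨σ, hσ, hne⟩ := exists_aut_of_two_regular (fun i j => A (e.symm i) (e.symm j))
    (fun v => hl _) (fun v => by rw [hcard (fun u => A (e.symm v) u), hout])
    (fun v => by rw [hcard (fun u => A u (e.symm v)), hin])
  refine ⟨e.trans (σ.trans e.symm), fun u v => by simpa using hσ (e u) (e v), fun h => hne ?_⟩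
  ext i
  have := congrArg (fun τ : Equiv.Perm V => e (τ (e.symm i))) h
  simpa using congrArg Fin.val this

lemma card_of_hasMDRR [Finite G] {m : ℕ} (hm : 2 ≤ m) (h : HasMDRR G m) :
    5 ≤ m * Nat.card G ∧ (Nat.card G = 1 → m ≠ 5) := by
  obtain ⟨V, _, A, ρ, hl, ⟨d, hd⟩, -, hfull, -, hfree, reps, hreps⟩ := h
  have hr : RegularRep A ρ d :=
    ⟨hl, fun v => (hd v).1, fun v => (hd v).2, hfull, hfree⟩
  have hab : ∀ g, ρ g (reps ⟨0, by omega⟩) ≠ reps ⟨1, by omega⟩ := fun g hg => by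
    have h01 : (⟨0, by omega⟩ : Fin m) = ⟨1, by omega⟩ :=
      (hreps (reps ⟨1, by omega⟩)).unique ⟨g, hg⟩ ⟨1, by simp⟩
    simp at h01
  have hle : Nat.card V ≤ m * Nat.card G := by
    have hsurj : Function.Surjective fun p : Fin m × G => ρ p.2 (reps p.1) := fun v => by
      obtain ⟨i, ⟨g, hg⟩, -⟩ := hreps v
      exact ⟨(i, g), hg⟩
    simpa [Nat.card_prod] using Nat.card_le_card_of_surjective _ hsurj
  obtain ⟨h1, h2⟩ := hr.valency_bounds hab
  refine ⟨by omega, fun hG hm5 => ?_⟩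
  subst hm5
  rw [hG] at hle
  obtain rfl : d = 2 := by omega
  obtain ⟨σ, hσ, hne⟩ := exists_aut_of_card_five (by omega) hl hr.outdeg hr.indeg
  obtain ⟨g, rfl⟩ := hfull σ hσ
  have := (Nat.card_eq_one_iff_unique.1 hG).1
  exact hne (by rw [Subsingleton.elim g 1, map_one])

end MCayley

namespace MCayley

variable {G : Type} [Group G]

lemma hasMDRR_congr {E : Type} [Group E] {m : ℕ} (e : G ≃* E) (h : HasMDRR G m) :
    HasMDRR E m := by
  obtain ⟨V, hV, A, ρ, hl, hd, haut, hfull, hinj, hfree, reps, hreps⟩ := h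
  refine ⟨V, hV, A, ρ.comp e.symm.toMonoidHom, hl, hd, fun g => haut _, fun σ hσ => ?_,
    hinj.comp e.symm.injective, fun g v hg => e.symm.injective ?_, reps, fun v => ?_⟩
  · obtain ⟨g, hg⟩ := hfull σ hσ
    exact ⟨e g, by simpa using hg⟩
  · rw [map_one]
    exact hfree _ v hg
  · have : ∀ i, (∃ g, ρ.comp e.symm.toMonoidHom g (reps i) = v) ↔ ∃ g, ρ g (reps i) = v :=
      fun i => e.symm.surjective.exists (p := fun g => ρ g (reps i) = v) |>.symm
    simpa only [this] using hreps v

/-- A DRR of `G` yields a subset of `G` that no nontrivial automorphism preserves. -/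
lemma exists_asymmetric_set (h : HasMDRR G 1) :
    ∃ S : Set G, ∀ φ : G ≃* G, (∀ x, φ x ∈ S ↔ x ∈ S) → φ = 1 := by
  obtain ⟨V, -, A, ρ, -, -, haut, hfull, -, hfree, reps, hreps⟩ := h
  have hbij : Function.Bijective fun g => ρ g (reps 0) := by
    refine ⟨fun g k hgk => ?_, fun v => ?_⟩
    · have hgk : ρ g (reps 0) = ρ k (reps 0) := hgk
      have := hfree (k⁻¹ * g) (reps 0) (by simp [hgk])
      rwa [inv_mul_eq_one, eq_comm] at this
    · obtain ⟨i, ⟨g, hg⟩, -⟩ := hreps v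
      rw [Subsingleton.elim i 0] at hg
      exact ⟨g, hg⟩
  let f : G ≃ V := Equiv.ofBijective _ hbij
  have hf : ∀ g, f g = ρ g (reps 0) := fun _ => rfl
  refine ⟨{s | A (reps 0) (f s)}, fun φ hφ => ?_⟩
  have hA : ∀ g k, A (f g) (f k) ↔ A (reps 0) (f (g⁻¹ * k)) := fun g k => by
    rw [← haut g⁻¹]
    simp [hf]
  have hσ : IsDigraphAut A (f.symm.trans (φ.toEquiv.trans f)) := fun u v => by
    obtain ⟨g, rfl⟩ := f.surjective u
    obtain ⟨k, rfl⟩ := f.surjective v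
    have := hφ (g⁻¹ * k)
    rw [map_mul, map_inv] at this
    simpa [hA g, hA (φ g)] using this
  obtain ⟨g, hg⟩ := hfull _ hσ
  have h1 : f 1 = reps 0 := by simp [hf]
  have hg1 : g = 1 := hfree g (reps 0) (by rw [hg, ← h1]; simp)
  ext x
  have := congrArg (fun σ : Equiv.Perm V => f.symm (σ (f x))) hg
  simpa [hg1] using this.symm

/-- Depth-first search over subsets, encoded as bit masks `s`: every branch has to end in a
subset that is compatible with one of the lists of pairs given for its level. -/
def search : List (List (List (ℕ × ℕ))) → ℕ → ℕ → Bool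
  | [], _, _ => false
  | L :: Ls, k, s =>
    (L.any fun t => t.all fun q =>
      Nat.beq (Nat.land 1 (Nat.shiftRight s q.1)) (Nat.land 1 (Nat.shiftRight s q.2))) ||
      (search Ls (k + 1) s && search Ls (k + 1) (2 ^ k + s))

/-- All indices in the `j`-th list are less than `k + j`. -/
def levelsBounded : List (List (List (ℕ × ℕ))) → ℕ → Bool
  | [], _ => true
  | L :: Ls, k =>
    (L.all fun t => t.all fun q => decide (q.1 < k) && decide (q.2 < k)) && levelsBounded Ls (k + 1)

lemma testBit_eq_of_beq {s i j : ℕ}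
    (h : Nat.beq (Nat.land 1 (Nat.shiftRight s i)) (Nat.land 1 (Nat.shiftRight s j))) :
    s.testBit i = s.testBit j := by
  have h : 1 &&& s >>> i = 1 &&& s >>> j := Nat.eq_of_beq_eq_true h
  simp only [Nat.testBit, h]

lemma exists_of_search (χ : ℕ → Bool) (Ls : List (List (List (ℕ × ℕ)))) :
    ∀ k s, s < 2 ^ k → (∀ i < k, s.testBit i = χ i) → levelsBounded Ls k → search Ls k s →
      ∃ L ∈ Ls, ∃ t ∈ L, ∀ q ∈ t, χ q.1 = χ q.2 := by
  induction Ls with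
  | nil => intro k s _ _ _ h; simp [search] at h
  | cons L Ls ih =>
    intro k s hs hχ hb h
    simp only [levelsBounded, Bool.and_eq_true, List.all_eq_true, decide_eq_true_eq] at hb
    simp only [search, Bool.or_eq_true, Bool.and_eq_true, List.any_eq_true,
      List.all_eq_true] at h
    obtain ⟨t, ht, h⟩ | ⟨h0, h1⟩ := h
    · refine ⟨L, by simp, t, ht, fun q hq => ?_⟩
      rw [← hχ _ (hb.1 t ht q hq).1, ← hχ _ (hb.1 t ht q hq).2, testBit_eq_of_beq (h q hq)]
    · obtain ⟨M, hM, hM'⟩ : ∃ M ∈ Ls, ∃ t ∈ M, ∀ q ∈ t, χ q.1 = χ q.2 := by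
        cases hk : χ k
        · refine ih (k + 1) s (hs.trans (Nat.pow_lt_pow_succ one_lt_two)) (fun i hi => ?_) hb.2 h0
          obtain hi | rfl := Nat.lt_succ_iff_lt_or_eq.1 hi
          · exact hχ i hi
          · rw [hk, Nat.testBit_lt_two_pow hs]
        · refine ih (k + 1) (2 ^ k + s) (by rw [pow_succ]; omega) (fun i hi => ?_) hb.2 h1
          obtain hi | rfl := Nat.lt_succ_iff_lt_or_eq.1 hi
          · rw [Nat.testBit_two_pow_add_gt hi, hχ i hi]
          · rw [hk, Nat.testBit_two_pow_add_eq, Nat.testBit_lt_two_pow hs]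
            rfl
      exact ⟨M, by simp [hM], hM'⟩

lemma not_hasMDRR_one_of_search (pt : ℕ → G) (Ls : List (List (List (ℕ × ℕ))))
    (hb : levelsBounded Ls 1) (hs : search Ls 1 0)
    (hmove : ∀ L ∈ Ls, ∀ t ∈ L, ∃ φ : G ≃* G, φ ≠ 1 ∧ ∀ x, φ x = x ∨
      ∃ q ∈ t, (pt q.1 = x ∧ pt q.2 = φ x) ∨ (pt q.1 = φ x ∧ pt q.2 = x)) :
    ¬ HasMDRR G 1 := by
  classical
  intro h
  obtain ⟨S, hS⟩ := exists_asymmetric_set h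
  obtain ⟨L, hL, t, ht, hq⟩ := exists_of_search
    (fun k => decide (pt k ∈ S) ^^ decide (pt 0 ∈ S)) Ls 1 0 (by simp) (by simp) hb hs
  simp only [Bool.xor_left_inj, decide_eq_decide] at hq
  obtain ⟨φ, hφ, hx⟩ := hmove L hL t ht
  refine hφ (hS φ fun x => ?_)
  obtain hx | ⟨q, hqt, ⟨h1, h2⟩ | ⟨h1, h2⟩⟩ := hx x
  · rw [hx]
  · simpa [h1, h2] using (hq q hqt).symm
  · simpa [h1, h2] using hq q hqt

end MCayley

namespace MCayley

/-- The pairs of indices in a search table. -/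
def tablePairs (Ls : List (List (ℕ × ℕ × List (ℕ × ℕ)))) : List (List (List (ℕ × ℕ))) :=
  Ls.map fun L => L.map fun t => t.2.2

/-- The vector whose `i`-th coordinate is `-1 - k_i`, where `k_i` is the `i`-th base `p` digit
of `k`. -/
def vec (p n k : ℕ) : Fin n → ZMod p := fun i => -1 - ((k / p ^ (i : ℕ) : ℕ) : ZMod p)

lemma exists_vec_eq {p n : ℕ} [NeZero p] (x : Fin n → ZMod p) : ∃ k < p ^ n, vec p n k = x := by
  let d : Fin n → Fin p := fun i => ⟨(-1 - x i).val, ZMod.val_lt _⟩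
  refine ⟨finFunctionFinEquiv d, (finFunctionFinEquiv d).2, ?_⟩
  funext i
  have h := congrArg Fin.val (congrFun (finFunctionFinEquiv.symm_apply_apply d) i)
  rw [finFunctionFinEquiv_symm_apply_val] at h
  rw [vec, ← ZMod.natCast_mod, h]
  simp [d]

/-- The pseudo-reflection `x ↦ x + (f ⬝ x) v`. -/
def reflection {p n : ℕ} (f v x : Fin n → ZMod p) : Fin n → ZMod p :=
  fun i => x i + (∑ j, f j * x j) * v i

lemma exists_reflection_equiv {p n : ℕ} [Fact p.Prime] {f v : Fin n → ZMod p}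
    (h : 1 + ∑ j, f j * v j ≠ 0) :
    ∃ e : (Fin n → ZMod p) ≃+ (Fin n → ZMod p), ∀ x, e x = reflection f v x := by
  let φ : (Fin n → ZMod p) →+ (Fin n → ZMod p) := AddMonoidHom.mk' (reflection f v) fun x y => by
    funext i
    simp only [reflection, Pi.add_apply, mul_add, Finset.sum_add_distrib]
    ring
  have hφ : Function.Injective φ := (injective_iff_map_eq_zero φ).2 fun x hx => by
    have hx' : ∀ i, x i + (∑ j, f j * x j) * v i = 0 := congrFun hx
    have hs : (∑ j, f j * x j) * (1 + ∑ j, f j * v j) = 0 := by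
      have : ∑ j, f j * (x j + (∑ j, f j * x j) * v j) = 0 :=
        Finset.sum_eq_zero fun j _ => by rw [hx', mul_zero]
      rw [← this]
      simp only [mul_add, Finset.sum_add_distrib, Finset.mul_sum, mul_one]
      congr 1
      exact Finset.sum_congr rfl fun j _ => by ring
    have hs := (mul_eq_zero.1 hs).resolve_right h
    funext i
    simpa [hs] using hx' i
  exact ⟨AddEquiv.ofBijective φ (Finite.injective_iff_bijective.1 hφ), fun x => rfl⟩

/-- The entry `t` of a search table describes the pseudo-reflection given by `t.1` and `t.2.1`. -/
def ReflectionEntry (p n : ℕ) (t : ℕ × ℕ × List (ℕ × ℕ)) : Prop :=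
  1 + ∑ j, vec p n t.1 j * vec p n t.2.1 j ≠ 0 ∧
    (∃ k < p ^ n, reflection (vec p n t.1) (vec p n t.2.1) (vec p n k) ≠ vec p n k) ∧
    ∀ k < p ^ n, reflection (vec p n t.1) (vec p n t.2.1) (vec p n k) = vec p n k ∨
      ∃ q ∈ t.2.2, (q.1 = k ∧ vec p n q.2 =
        reflection (vec p n t.1) (vec p n t.2.1) (vec p n k)) ∨
      (q.2 = k ∧ vec p n q.1 = reflection (vec p n t.1) (vec p n t.2.1) (vec p n k))

instance (p n : ℕ) (t : ℕ × ℕ × List (ℕ × ℕ)) : Decidable (ReflectionEntry p n t) := by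
  unfold ReflectionEntry
  infer_instance

lemma not_hasMDRR_one_of_table {p n : ℕ} [Fact p.Prime]
    (Ls : List (List (ℕ × ℕ × List (ℕ × ℕ)))) (hb : levelsBounded (tablePairs Ls) 1)
    (hs : search (tablePairs Ls) 1 0) (he : ∀ L ∈ Ls, ∀ t ∈ L, ReflectionEntry p n t) :
    ¬ HasMDRR (Multiplicative (Fin n → ZMod p)) 1 := by
  refine not_hasMDRR_one_of_search (fun k => Multiplicative.ofAdd (vec p n k)) _ hb hs ?_
  simp only [tablePairs, List.mem_map, forall_exists_index, and_imp, forall_apply_eq_imp_iff₂]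
  intro L hL t ht
  obtain ⟨h1, ⟨k, -, hk⟩, h3⟩ := he L hL t ht
  obtain ⟨e, he⟩ := exists_reflection_equiv h1
  refine ⟨AddEquiv.toMultiplicative e, fun h => hk ?_, fun x => ?_⟩
  · rw [← he]
    exact congrArg (fun φ : Multiplicative (Fin n → ZMod p) ≃* _ =>
      (φ (Multiplicative.ofAdd (vec p n k))).toAdd) h
  · obtain ⟨k, hk, hx⟩ := exists_vec_eq x.toAdd
    obtain rfl : Multiplicative.ofAdd (vec p n k) = x := hx
    have hφ : AddEquiv.toMultiplicative e (Multiplicative.ofAdd (vec p n k)) =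
      Multiplicative.ofAdd (reflection (vec p n t.1) (vec p n t.2.1) (vec p n k)) :=
      congrArg Multiplicative.ofAdd (he _)
    rw [hφ]
    obtain h | ⟨q, hq, ⟨rfl, h⟩ | ⟨rfl, h⟩⟩ := h3 k hk
    · exact Or.inl (congrArg Multiplicative.ofAdd h)
    · exact Or.inr ⟨q, hq, Or.inl ⟨rfl, congrArg Multiplicative.ofAdd h⟩⟩
    · exact Or.inr ⟨q, hq, Or.inr ⟨congrArg Multiplicative.ofAdd h, rfl⟩⟩

/-- A search table for `(ℤ/2)²`. -/
def binaryTableTwo : List (List (ℕ × ℕ × List (ℕ × ℕ))) := [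
    [], [(1, 2, [(0, 1)])], [(0, 0, [(1, 2)]), (2, 1, [(0, 2)])]]

/-- A search table for `(ℤ/2)³`. -/
def binaryTableThree : List (List (ℕ × ℕ × List (ℕ × ℕ))) := [
    [], [], [], [(3, 5, [(0, 2), (1, 3)])], [], [(5, 2, [(0, 5), (1, 4)]),
    (1, 0, [(2, 5), (3, 4)])], [(2, 2, [(1, 4), (3, 6)]), (4, 0, [(1, 6), (2, 5)]),
    (6, 5, [(0, 2), (4, 6)]), (2, 5, [(1, 3), (4, 6)]), (0, 2, [(0, 5), (3, 6)]),
    (2, 0, [(1, 6), (3, 4)])]]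

/-- A search table for `(ℤ/2)⁴`. -/
def binaryTableFour : List (List (ℕ × ℕ × List (ℕ × ℕ))) := [
    [], [], [], [], [], [], [], [(7, 8, [(0, 7), (1, 6), (2, 5), (3, 4)]),
    (7, 9, [(0, 6), (1, 7), (2, 4), (3, 5)]), (7, 14, [(0, 1), (2, 3), (4, 5), (6, 7)]),
    (7, 10, [(0, 5), (1, 4), (2, 7), (3, 6)]), (7, 11, [(0, 4), (1, 5), (2, 6), (3, 7)]),
    (7, 12, [(0, 3), (1, 2), (4, 7), (5, 6)]), (7, 13, [(0, 2), (1, 3), (4, 6), (5, 7)])], [],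
    [], [], [(3, 0, [(4, 11), (5, 10), (6, 9), (7, 8)]),
    (11, 4, [(0, 11), (1, 10), (2, 9), (3, 8)]), (3, 1, [(4, 10), (5, 11), (6, 8), (7, 9)]),
    (11, 5, [(0, 10), (1, 11), (2, 8), (3, 9)]), (3, 2, [(4, 9), (5, 8), (6, 11), (7, 10)]),
    (11, 6, [(0, 9), (1, 8), (2, 11), (3, 10)]), (3, 3, [(4, 8), (5, 9), (6, 10), (7, 11)]),
    (3, 12, [(4, 7), (5, 6), (8, 11), (9, 10)]), (11, 7, [(0, 8), (1, 9), (2, 10), (3, 11)]),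
    (11, 12, [(0, 3), (1, 2), (8, 11), (9, 10)]), (3, 13, [(4, 6), (5, 7), (8, 10), (9, 11)]),
    (3, 14, [(4, 5), (6, 7), (8, 9), (10, 11)]), (11, 13, [(0, 2), (1, 3), (8, 10), (9, 11)]),
    (11, 14, [(0, 1), (2, 3), (8, 9), (10, 11)])], [],
    [(1, 2, [(0, 13), (1, 12), (6, 11), (7, 10)]), (5, 0, [(2, 13), (3, 12), (6, 9), (7, 8)]),
    (9, 0, [(2, 13), (3, 12), (4, 11), (5, 10)]), (13, 2, [(0, 13), (1, 12), (4, 9), (5, 8)]),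
    (1, 4, [(0, 11), (1, 10), (6, 13), (7, 12)]), (1, 9, [(0, 6), (1, 7), (10, 12), (11, 13)]),
    (5, 4, [(2, 9), (3, 8), (6, 13), (7, 12)]), (5, 11, [(2, 6), (3, 7), (8, 12), (9, 13)]),
    (9, 6, [(2, 11), (3, 10), (4, 13), (5, 12)]), (9, 9, [(2, 4), (3, 5), (10, 12), (11, 13)]),
    (13, 6, [(0, 9), (1, 8), (4, 13), (5, 12)]), (13, 11, [(0, 4), (1, 5), (8, 12), (9, 13)]),
    (1, 3, [(0, 12), (1, 13), (6, 10), (7, 11)]), (1, 5, [(0, 10), (1, 11), (6, 12), (7, 13)]),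
    (1, 8, [(0, 7), (1, 6), (10, 13), (11, 12)]), (5, 1, [(2, 12), (3, 13), (6, 8), (7, 9)]),
    (5, 5, [(2, 8), (3, 9), (6, 12), (7, 13)]), (5, 10, [(2, 7), (3, 6), (8, 13), (9, 12)]),
    (9, 1, [(2, 12), (3, 13), (4, 10), (5, 11)]), (9, 7, [(2, 10), (3, 11), (4, 12), (5, 13)]),
    (9, 8, [(2, 5), (3, 4), (10, 13), (11, 12)]), (13, 3, [(0, 12), (1, 13), (4, 8), (5, 9)]),
    (13, 7, [(0, 8), (1, 9), (4, 12), (5, 13)]), (13, 10, [(0, 5), (1, 4), (8, 13), (9, 12)])],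
    [(0, 0, [(1, 14), (2, 13), (4, 11), (7, 8)]), (0, 3, [(1, 13), (2, 14), (4, 8), (7, 11)]),
    (0, 5, [(1, 11), (2, 8), (4, 14), (7, 13)]), (0, 6, [(1, 8), (2, 11), (4, 13), (7, 14)]),
    (0, 9, [(1, 7), (2, 4), (8, 14), (11, 13)]), (0, 10, [(1, 4), (2, 7), (8, 13), (11, 14)]),
    (0, 12, [(1, 2), (4, 7), (8, 11), (13, 14)]), (2, 1, [(0, 14), (2, 12), (5, 11), (7, 9)]),
    (2, 4, [(0, 11), (2, 9), (5, 14), (7, 12)]), (2, 8, [(0, 7), (2, 5), (9, 14), (11, 12)]),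
    (2, 13, [(0, 2), (5, 7), (9, 11), (12, 14)]), (4, 2, [(0, 13), (3, 14), (4, 9), (7, 10)]),
    (4, 11, [(0, 4), (3, 7), (9, 13), (10, 14)]), (8, 2, [(0, 13), (3, 14), (5, 8), (6, 11)]),
    (8, 7, [(0, 8), (3, 11), (5, 13), (6, 14)]), (12, 7, [(1, 9), (2, 10), (5, 13), (6, 14)]),
    (12, 11, [(1, 5), (2, 6), (9, 13), (10, 14)]), (6, 2, [(1, 12), (3, 14), (5, 8), (7, 10)]),
    (6, 11, [(1, 5), (3, 7), (8, 12), (10, 14)]), (6, 13, [(1, 3), (5, 7), (8, 10), (12, 14)]),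
    (10, 7, [(1, 9), (3, 11), (4, 12), (6, 14)]), (14, 7, [(0, 8), (2, 10), (4, 12), (6, 14)]),
    (2, 3, [(0, 12), (2, 14), (5, 9), (7, 11)]), (2, 10, [(0, 5), (2, 7), (9, 12), (11, 14)]),
    (4, 1, [(0, 14), (3, 13), (4, 10), (7, 9)]), (4, 5, [(0, 10), (3, 9), (4, 14), (7, 13)]),
    (4, 8, [(0, 7), (3, 4), (9, 14), (10, 13)]), (6, 0, [(1, 14), (3, 12), (5, 10), (7, 8)]),
    (6, 4, [(1, 10), (3, 8), (5, 14), (7, 12)]), (6, 9, [(1, 7), (3, 5), (8, 14), (10, 12)]),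
    (4, 12, [(0, 3), (4, 7), (9, 10), (13, 14)]), (8, 1, [(0, 14), (3, 13), (5, 11), (6, 8)]),
    (8, 4, [(0, 11), (3, 8), (5, 14), (6, 13)]), (8, 9, [(0, 6), (3, 5), (8, 14), (11, 13)]),
    (8, 10, [(0, 5), (3, 6), (8, 13), (11, 14)]), (8, 12, [(0, 3), (5, 6), (8, 11), (13, 14)]),
    (10, 0, [(1, 14), (3, 12), (4, 11), (6, 9)]), (10, 5, [(1, 11), (3, 9), (4, 14), (6, 12)]),
    (10, 8, [(1, 6), (3, 4), (9, 14), (11, 12)]), (10, 13, [(1, 3), (4, 6), (9, 11), (12, 14)]),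
    (12, 3, [(1, 13), (2, 14), (5, 9), (6, 10)])]]

/-- A search table for `(ℤ/3)²`. -/
def ternaryTableTwo : List (List (ℕ × ℕ × List (ℕ × ℕ))) := [
    [], [], [], [], [], [(2, 0, [(0, 4), (1, 5), (2, 3)]), (2, 2, [(0, 3), (1, 4), (2, 5)]),
    (2, 6, [(0, 1), (1, 2), (2, 0), (3, 5), (4, 3), (5, 4)]), (2, 1, [(0, 5), (1, 3), (2, 4)])],
    [], [(0, 6, [(0, 2), (4, 5), (6, 7)]), (6, 3, [(0, 7), (1, 3), (4, 6)]),
    (6, 6, [(0, 1), (3, 4), (6, 7)]), (1, 4, [(1, 5), (2, 7), (3, 2), (5, 6), (6, 1), (7, 3)]),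
    (1, 3, [(1, 3), (2, 6), (5, 7)]), (0, 2, [(0, 6), (2, 5), (4, 7)]),
    (0, 4, [(0, 4), (2, 7), (5, 6)]), (1, 2, [(1, 7), (2, 5), (3, 6)]),
    (6, 2, [(0, 3), (1, 7), (3, 6), (4, 1), (6, 0), (7, 4)]),
    (0, 3, [(0, 5), (2, 6), (4, 2), (5, 7), (6, 4), (7, 0)]), (1, 7, [(1, 2), (3, 5), (6, 7)]),
    (6, 0, [(0, 4), (1, 6), (3, 7)])]]

lemma not_hasMDRR_binary_two : ¬ HasMDRR (Multiplicative (Fin 2 → ZMod 2)) 1 :=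
  not_hasMDRR_one_of_table binaryTableTwo (by decide +kernel) (by decide +kernel)
    (by decide +kernel)

lemma not_hasMDRR_binary_three : ¬ HasMDRR (Multiplicative (Fin 3 → ZMod 2)) 1 :=
  not_hasMDRR_one_of_table binaryTableThree (by decide +kernel) (by decide +kernel)
    (by decide +kernel)

lemma not_hasMDRR_binary_four : ¬ HasMDRR (Multiplicative (Fin 4 → ZMod 2)) 1 :=
  not_hasMDRR_one_of_table binaryTableFour (by decide +kernel) (by decide +kernel)
    (by decide +kernel)

lemma not_hasMDRR_ternary_two : ¬ HasMDRR (Multiplicative (Fin 2 → ZMod 3)) 1 :=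
  not_hasMDRR_one_of_table ternaryTableTwo (by decide +kernel) (by decide +kernel)
    (by decide +kernel)

/-- The element `a^i` or `xa^i` of the quaternion group indexed by `k` in search tables. -/
def quaternionPoint (k : ℕ) : QuaternionGroup 2 :=
  [.a 1, .a 3, .xa 0, .xa 2, .xa 1, .xa 3, .a 0, .a 2].getD k 1

/-- The endomorphism of the quaternion group with `a ↦ g`, `x ↦ h`. -/
def quaternionMap (g h : QuaternionGroup 2) : QuaternionGroup 2 → QuaternionGroup 2
  | .a i => g ^ i.val
  | .xa i => h * g ^ i.val

/-- A search table for the quaternion group. -/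
def quaternionTable : List (List (ℕ × ℕ × List (ℕ × ℕ))) := [
    [], [], [], [(1, 3, [(0, 1), (2, 3)])], [], [(1, 2, [(0, 1), (4, 5)]),
    (5, 3, [(0, 5), (1, 4), (2, 3)]), (4, 3, [(0, 4), (1, 5), (2, 3)]),
    (2, 5, [(0, 2), (1, 3), (2, 5), (3, 4), (4, 1), (5, 0)]), (0, 3, [(2, 3), (4, 5)]),
    (2, 0, [(0, 2), (1, 3), (4, 5)]), (5, 1, [(0, 5), (1, 4), (2, 1), (3, 0), (4, 2), (5, 3)]),
    (3, 5, [(0, 3), (1, 2), (2, 5), (3, 4), (4, 0), (5, 1)]), (3, 1, [(0, 3), (1, 2), (4, 5)]),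
    (1, 4, [(0, 1), (2, 4), (3, 5)]), (1, 5, [(0, 1), (2, 5), (3, 4)]),
    (4, 0, [(0, 4), (1, 5), (2, 0), (3, 1), (4, 2), (5, 3)])]]

lemma quaternionTable_spec : ∀ L ∈ quaternionTable, ∀ t ∈ L,
    let φ := quaternionMap (quaternionPoint t.1) (quaternionPoint t.2.1)
    (∀ x y, φ (x * y) = φ x * φ y) ∧ Function.Injective φ ∧ (∃ x, φ x ≠ x) ∧ ∀ x, φ x = x ∨
      ∃ q ∈ t.2.2, (quaternionPoint q.1 = x ∧ quaternionPoint q.2 = φ x) ∨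
        (quaternionPoint q.1 = φ x ∧ quaternionPoint q.2 = x) := by
  decide +kernel

lemma not_hasMDRR_quaternion : ¬ HasMDRR (QuaternionGroup 2) 1 := by
  refine not_hasMDRR_one_of_search quaternionPoint (tablePairs quaternionTable)
    (by decide +kernel) (by decide +kernel) ?_
  simp only [tablePairs, List.mem_map, forall_exists_index, and_imp, forall_apply_eq_imp_iff₂]
  intro L hL t ht
  obtain ⟨h1, h2, ⟨x, hx⟩, h3⟩ := quaternionTable_spec L hL t ht
  refine ⟨MulEquiv.ofBijective (MonoidHom.mk' _ h1) (Finite.injective_iff_bijective.1 h2),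
    fun h => hx ?_, h3⟩
  exact congrArg (fun φ : QuaternionGroup 2 ≃* QuaternionGroup 2 => φ x) h

end MCayley

/-- classification of finite groups admitting an m-DRR. -/
theorem statement_1 (m : ℕ) (hm : 1 ≤ m) (G : Type) [Group G] [Finite G] :
    HasMDRR G m ↔
      ¬ ((m = 1 ∧ (Nonempty (G ≃* QuaternionGroup 2) ∨
            Nonempty (G ≃* Multiplicative (Fin 2 → ZMod 2)) ∨
            Nonempty (G ≃* Multiplicative (Fin 3 → ZMod 2)) ∨
            Nonempty (G ≃* Multiplicative (Fin 4 → ZMod 2)) ∨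
            Nonempty (G ≃* Multiplicative (Fin 2 → ZMod 3)))) ∨
         (m = 2 ∧ (Nat.card G = 1 ∨ Nonempty (G ≃* Multiplicative (ZMod 2)))) ∨
         ((m = 3 ∨ m = 4 ∨ m = 5) ∧ Nat.card G = 1)) := by
  have hpos : 0 < Nat.card G := Nat.card_pos
  constructor
  · rintro h (⟨rfl, ⟨⟨e⟩⟩ | ⟨⟨e⟩⟩ | ⟨⟨e⟩⟩ | ⟨⟨e⟩⟩ | ⟨⟨e⟩⟩⟩ | ⟨rfl, hG⟩ | ⟨hm, hG⟩)
    · exact MCayley.not_hasMDRR_quaternion (MCayley.hasMDRR_congr e h)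
    · exact MCayley.not_hasMDRR_binary_two (MCayley.hasMDRR_congr e h)
    · exact MCayley.not_hasMDRR_binary_three (MCayley.hasMDRR_congr e h)
    · exact MCayley.not_hasMDRR_binary_four (MCayley.hasMDRR_congr e h)
    · exact MCayley.not_hasMDRR_ternary_two (MCayley.hasMDRR_congr e h)
    · have hcard : Nat.card G ≤ 2 := by
        obtain hG | ⟨⟨e⟩⟩ := hG
        · omega
        · simp [Nat.card_congr e.toEquiv]
      have := (MCayley.card_of_hasMDRR le_rfl h).1
      omega
    · have := MCayley.card_of_hasMDRR (by omega) h
      rw [hG] at this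
      omega
  · intro h
    push Not at h
    obtain ⟨h1, h2, h3⟩ := h
    obtain rfl | rfl | hm3 : m = 1 ∨ m = 2 ∨ 3 ≤ m := by omega
    · by_contra hno
      have := MCayley.exception_of_not_hasMDRR_one hno
      simp only [← not_nonempty_iff] at h1
      tauto
    · refine MCayley.hasMDRR_two ?_
      by_contra hcard
      obtain ⟨hG1, hG2⟩ := h2 rfl
      have : Fact (Nat.Prime 2) := ⟨Nat.prime_two⟩
      exact hG2.false (mulEquivOfPrimeCardEq (p := 2) (by omega) (by simp))
    · by_cases hG : Nat.card G = 1
      · exact MCayley.hasMDRR_trivial hG (by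
          by_contra hm6
          exact h3 (by omega) hG)
      · exact MCayley.hasMDRR_of_three_le hm3 (by omega)
end

section
/- Let G, R, L, S, T, x be as in the Θᵐ(G,R,L,S,T,x) construction, let m ≥ 3, let Θᵐ := Θᵐ(G,R,L,S,T,x) and Θ³ := Θ³(G,R,L,S,T,x). Then the induced subgraph on the neighborhood of 1_0 in Θᵐ is isomorphic to the induced subgraph on the neighborhood of 1_0 in Θ³; the induced subgraph on the neighborhood of 1_1 in Θᵐ is isomorphic to that of 1_1 in Θ³; and for each i ∈ {2,…,m−1}, the induced subgraph on the neighborhood of 1_i in Θᵐ is isomorphic to that of 1_2 in Θ³. -/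
/-- The graph `Θᵐ(G,R,L,S,T,x)` on `G × {0,…,m−1}` with edges `{g_0,(rg)_0}` for `r ∈ R`;
`{g_1,(lg)_1}` for `l ∈ L`; `{g_0,(sg)_1}` for `s ∈ S`; `{g_i,(tg)_i}` for `t ∈ T`,
`2 ≤ i ≤ m−1`; `{g_i,g_{i+1}}` for `1 ≤ i ≤ m−2`; and `{g_0,(xg)_{m−1}}`. -/
def ThetaM (G : Type*) [Group G] (m : ℕ) (R L S T : Set G) (x : G) :
    SimpleGraph (G × Fin m) :=
  SimpleGraph.fromRel (fun p q =>
    (p.2.val = 0 ∧ q.2.val = 0 ∧ q.1 * p.1⁻¹ ∈ R) ∨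
    (p.2.val = 1 ∧ q.2.val = 1 ∧ q.1 * p.1⁻¹ ∈ L) ∨
    (p.2.val = 0 ∧ q.2.val = 1 ∧ q.1 * p.1⁻¹ ∈ S) ∨
    (2 ≤ p.2.val ∧ p.2 = q.2 ∧ q.1 * p.1⁻¹ ∈ T) ∨
    (1 ≤ p.2.val ∧ q.2.val = p.2.val + 1 ∧ q.1 = p.1) ∨
    (p.2.val = 0 ∧ q.2.val = m - 1 ∧ q.1 = x * p.1))

/-- Two injective parametrisations of vertex sets by the same type that induce the same adjacency
give an isomorphism of induced subgraphs. -/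
theorem SimpleGraph.nonempty_induce_iso_of_param {α V W : Type*} {Γ : SimpleGraph V}
    {Δ : SimpleGraph W} {s : Set V} {t : Set W} (f : α → V) (g : α → W)
    (hf : Function.Injective f) (hg : Function.Injective g)
    (hs : Set.range f = s) (ht : Set.range g = t)
    (h : ∀ a b, Γ.Adj (f a) (f b) ↔ Δ.Adj (g a) (g b)) :
    Nonempty (Γ.induce s ≃g Δ.induce t) := by
  subst hs ht
  refine ⟨⟨(Equiv.ofInjective f hf).symm.trans (Equiv.ofInjective g hg), ?_⟩⟩
  rintro ⟨_, a, rfl⟩ ⟨_, b, rfl⟩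
  simp [h]

namespace ThetaM

variable {G : Type*}

/-- The neighbours of `1_0`: the vertices `r_0`, `s_1` and `x_{m-1}`. -/
def nbrZero (m : ℕ) (hm : 3 ≤ m) (R S : Set G) (x : G) : R ⊕ S ⊕ Unit → G × Fin m
  | .inl r => (r, ⟨0, by omega⟩)
  | .inr (.inl s) => (s, ⟨1, by omega⟩)
  | .inr (.inr _) => (x, ⟨m - 1, by omega⟩)

/-- The neighbours of `1_1`: the vertices `l_1`, `(s⁻¹)_0` and `1_2`. -/
def nbrOne [Group G] (m : ℕ) (hm : 3 ≤ m) (L S : Set G) : L ⊕ S ⊕ Unit → G × Fin m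
  | .inl l => (l, ⟨1, by omega⟩)
  | .inr (.inl s) => ((s : G)⁻¹, ⟨0, by omega⟩)
  | .inr (.inr _) => (1, ⟨2, by omega⟩)

/-- The neighbours of `1_i` for `2 ≤ i`: the vertices `t_i` and `1_{i-1}`, together with
`(x⁻¹)_0` if `i = m - 1` and `1_{i+1}` otherwise. -/
def nbrTwo [Group G] (m : ℕ) (i : Fin m) (T : Set G) (x : G) : T ⊕ Bool → G × Fin m
  | .inl t => (t, i)
  | .inr false => (1, ⟨i - 1, by omega⟩)
  | .inr true => if h : i.val = m - 1 then (x⁻¹, ⟨0, by omega⟩) else (1, ⟨i + 1, by omega⟩)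

variable {m : ℕ} {R L S T : Set G} {x : G}

theorem inv_mem_iff_of_inv_mem [Group G] {A : Set G} (hA : ∀ a ∈ A, a⁻¹ ∈ A) (g : G) :
    g⁻¹ ∈ A ↔ g ∈ A :=
  ⟨fun h => by simpa using hA _ h, hA g⟩

theorem nbrZero_injective (hm : 3 ≤ m) : Function.Injective (nbrZero m hm R S x) := by
  rintro (⟨a, ha⟩ | ⟨a, ha⟩ | _) (⟨b, hb⟩ | ⟨b, hb⟩ | _) h <;>
    simp [nbrZero] at h ⊢ <;> grind

theorem nbrOne_injective [Group G] (hm : 3 ≤ m) : Function.Injective (nbrOne m hm L S) := by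
  rintro (⟨a, ha⟩ | ⟨a, ha⟩ | _) (⟨b, hb⟩ | ⟨b, hb⟩ | _) h <;>
    simp [nbrOne] at h ⊢ <;> exact h

theorem nbrTwo_injective [Group G] {i : Fin m} (hi : 2 ≤ i.val) :
    Function.Injective (nbrTwo m i T x) := by
  rintro (⟨a, ha⟩ | _ | _) (⟨b, hb⟩ | _ | _) h <;>
    simp [nbrTwo] at h ⊢ <;> grind

theorem range_nbrZero [Group G] (hm : 3 ≤ m) (h1R : (1 : G) ∉ R) (hRinv : ∀ r ∈ R, r⁻¹ ∈ R) :
    Set.range (nbrZero m hm R S x) =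
      (ThetaM G m R L S T x).neighborSet (1, ⟨0, by omega⟩) := by
  ext ⟨g, j, hj⟩
  have hR := inv_mem_iff_of_inv_mem hRinv
  clear hRinv
  simp [nbrZero, ThetaM, Fin.ext_iff, hR]
  grind

theorem range_nbrOne [Group G] (hm : 3 ≤ m) (h1L : (1 : G) ∉ L) (hLinv : ∀ l ∈ L, l⁻¹ ∈ L) :
    Set.range (nbrOne m hm L S) =
      (ThetaM G m R L S T x).neighborSet (1, ⟨1, by omega⟩) := by
  ext ⟨g, j, hj⟩
  have hL := inv_mem_iff_of_inv_mem hLinv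
  clear hLinv
  simp [nbrOne, ThetaM, Fin.ext_iff, hL, inv_eq_iff_eq_inv]
  grind

theorem range_nbrTwo [Group G] {i : Fin m} (hi : 2 ≤ i.val)
    (h1T : (1 : G) ∉ T) (hTinv : ∀ t ∈ T, t⁻¹ ∈ T) :
    Set.range (nbrTwo m i T x) = (ThetaM G m R L S T x).neighborSet (1, i) := by
  ext ⟨g, j, hj⟩
  have hT := inv_mem_iff_of_inv_mem hTinv
  clear hTinv
  have hg : 1 = x * g ↔ x⁻¹ = g := by rw [eq_comm, mul_eq_one_iff_inv_eq]
  by_cases h : i.val = m - 1 <;> simp [nbrTwo, ThetaM, Fin.ext_iff, hT, h, hg] <;>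
    grind (splits := 20)

theorem adj_nbrZero_iff [Group G] (hm : 3 ≤ m) (hx : x ∉ S) (a b : R ⊕ S ⊕ Unit) :
    (ThetaM G m R L S T x).Adj (nbrZero m hm R S x a) (nbrZero m hm R S x b) ↔
      (ThetaM G 3 R L S T x).Adj (nbrZero 3 le_rfl R S x a) (nbrZero 3 le_rfl R S x b) := by
  rcases a with ⟨a, ha⟩ | ⟨a, ha⟩ | _ <;> rcases b with ⟨b, hb⟩ | ⟨b, hb⟩ | _ <;>
    simp [nbrZero, ThetaM] <;> grind

theorem adj_nbrOne_iff [Group G] (hm : 3 ≤ m) (hx : x ∉ S) (a b : L ⊕ S ⊕ Unit) :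
    (ThetaM G m R L S T x).Adj (nbrOne m hm L S a) (nbrOne m hm L S b) ↔
      (ThetaM G 3 R L S T x).Adj (nbrOne 3 le_rfl L S a) (nbrOne 3 le_rfl L S b) := by
  rcases a with ⟨a, ha⟩ | ⟨a, ha⟩ | _ <;> rcases b with ⟨b, hb⟩ | ⟨b, hb⟩ | _ <;>
    simp [nbrOne, ThetaM, eq_mul_inv_iff_mul_eq] <;> grind

theorem adj_nbrTwo_iff [Group G] {i : Fin m} (hi : 2 ≤ i.val) (h1T : (1 : G) ∉ T) (hx : x ∉ S)
    (a b : T ⊕ Bool) :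
    (ThetaM G m R L S T x).Adj (nbrTwo m i T x a) (nbrTwo m i T x b) ↔
      (ThetaM G 3 R L S T x).Adj (nbrTwo 3 2 T x a) (nbrTwo 3 2 T x b) := by
  by_cases h : i.val = m - 1 <;>
  rcases a with ⟨a, ha⟩ | _ | _ <;> rcases b with ⟨b, hb⟩ | _ | _ <;>
    simp [nbrTwo, ThetaM, h] <;> grind

end ThetaM

/-- the neighbourhood subgraphs of `1_0`, `1_1` and `1_i` (for `2 ≤ i ≤ m−1`)
in `Θᵐ(G,R,L,S,T,x)` are isomorphic to those of `1_0`, `1_1` and `1_2` in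
`Θ³(G,R,L,S,T,x)`, respectively. -/
theorem statement_11 (G : Type*) [Group G] [Finite G]
    (m : ℕ) (hm : 3 ≤ m)
    (R L S T : Set G)
    (h1R : (1 : G) ∉ R) (hRinv : ∀ r ∈ R, r⁻¹ ∈ R)
    (h1L : (1 : G) ∉ L) (hLinv : ∀ l ∈ L, l⁻¹ ∈ L)
    (h1T : (1 : G) ∉ T) (hTinv : ∀ t ∈ T, t⁻¹ ∈ T)
    (hcard : R.ncard = L.ncard ∧ R.ncard + S.ncard = T.ncard + 1)
    (x : G) (hx : x ∉ S) :
    Nonempty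
      ((ThetaM G m R L S T x).induce
          ((ThetaM G m R L S T x).neighborSet ((1 : G), (⟨0, by omega⟩ : Fin m))) ≃g
        (ThetaM G 3 R L S T x).induce
          ((ThetaM G 3 R L S T x).neighborSet ((1 : G), (0 : Fin 3)))) ∧
    Nonempty
      ((ThetaM G m R L S T x).induce
          ((ThetaM G m R L S T x).neighborSet ((1 : G), (⟨1, by omega⟩ : Fin m))) ≃g
        (ThetaM G 3 R L S T x).induce
          ((ThetaM G 3 R L S T x).neighborSet ((1 : G), (1 : Fin 3)))) ∧
    (∀ i : Fin m, 2 ≤ i.val →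
      Nonempty
        ((ThetaM G m R L S T x).induce
            ((ThetaM G m R L S T x).neighborSet ((1 : G), i)) ≃g
          (ThetaM G 3 R L S T x).induce
            ((ThetaM G 3 R L S T x).neighborSet ((1 : G), (2 : Fin 3))))) := by
  refine ⟨?_, ?_, fun i hi => ?_⟩
  · exact SimpleGraph.nonempty_induce_iso_of_param _ _
      (ThetaM.nbrZero_injective hm) (ThetaM.nbrZero_injective le_rfl)
      (ThetaM.range_nbrZero hm h1R hRinv) (ThetaM.range_nbrZero le_rfl h1R hRinv)
      (ThetaM.adj_nbrZero_iff hm hx)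
  · exact SimpleGraph.nonempty_induce_iso_of_param _ _
      (ThetaM.nbrOne_injective hm) (ThetaM.nbrOne_injective le_rfl)
      (ThetaM.range_nbrOne hm h1L hLinv) (ThetaM.range_nbrOne le_rfl h1L hLinv)
      (ThetaM.adj_nbrOne_iff hm hx)
  · exact SimpleGraph.nonempty_induce_iso_of_param _ _
      (ThetaM.nbrTwo_injective hi) (ThetaM.nbrTwo_injective le_rfl)
      (ThetaM.range_nbrTwo hi h1T hTinv) (ThetaM.range_nbrTwo le_rfl h1T hTinv)
      (ThetaM.adj_nbrTwo_iff hi h1T hx)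
end
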